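/- Suppose a, b, c are positive integers with c odd, and (x1, y1, z1), (x2, y2, z2) are positive integer solutions of a^x + b^y = c^z with x1 ≡ x2 (mod 2) and y1 ≡ y2 (mod 2). If a and b are both even, then the solutions are equal, i.e., (x1, y1, z1) = (x2, y2, z2) is not forced in general, but there is at most one solution in each parity class for each divisor pattern; in particular, the total number of solutions is at most 2·2^(ω(c)−1) = 2^ω(c) when ω(c) ≥ 1. -/

import Mathlib

/-- `(α+β)^(2*m+1) = α F + β G` where `α^2 = X`, `β^2 = -Y`. -/
def stFG (X Y : ℤ) : ℕ → ℤ × ℤ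
  | 0 => (1, 1)
  | m + 1 => ((X - Y) * (stFG X Y m).1 - 2 * Y * (stFG X Y m).2,
      (X - Y) * (stFG X Y m).2 + 2 * X * (stFG X Y m).1)

def stF (X Y : ℤ) (m : ℕ) : ℤ := (stFG X Y m).1
def stG (X Y : ℤ) (m : ℕ) : ℤ := (stFG X Y m).2

lemma stF_zero (X Y : ℤ) : stF X Y 0 = 1 := rfl
lemma stG_zero (X Y : ℤ) : stG X Y 0 = 1 := rfl
lemma stF_succ (X Y : ℤ) (m : ℕ) :
    stF X Y (m+1) = (X - Y) * stF X Y m - 2 * Y * stG X Y m := rfl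
lemma stG_succ (X Y : ℤ) (m : ℕ) :
    stG X Y (m+1) = (X - Y) * stG X Y m + 2 * X * stF X Y m := rfl

lemma stG_swap (X Y : ℤ) (m : ℕ) :
    stG X Y m = (-1)^m * stF Y X m ∧ stF X Y m = (-1)^m * stG Y X m := by
  induction m with
  | zero => simp [stF_zero, stG_zero]
  | succ m ih =>
    obtain ⟨h1, h2⟩ := ih
    rw [stF_succ, stG_succ, stF_succ, stG_succ, h1, h2]
    constructor <;> ring

lemma st_norm (X Y : ℤ) (m : ℕ) :
    X * stF X Y m ^ 2 + Y * stG X Y m ^ 2 = (X + Y) ^ (2 * m + 1) := by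
  induction m with
  | zero => simp [stF_zero, stG_zero]
  | succ m ih =>
    rw [stF_succ, stG_succ, show 2 * (m + 1) + 1 = (2 * m + 1) + 2 by ring, pow_add, ← ih]
    ring

lemma st_pow {R : Type*} [CommRing R] (X Y : ℤ) (α β : R) (hα : α ^ 2 = X) (hβ : β ^ 2 = -Y)
    (m : ℕ) : (α + β) ^ (2 * m + 1) = α * stF X Y m + β * stG X Y m := by
  induction m with
  | zero => simp [stF_zero, stG_zero]
  | succ m ih =>
    rw [stF_succ, stG_succ, show 2 * (m + 1) + 1 = (2 * m + 1) + 2 by ring, pow_add, ih]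
    push_cast
    have hY : (Y : R) = - β ^ 2 := by rw [hβ]; ring
    rw [hY, ← hα]; ring

lemma st_comp (X Y : ℤ) (hX : 0 < X) (hY : 0 < Y) (i j m : ℕ)
    (h : 2 * m + 1 = (2 * i + 1) * (2 * j + 1)) :
    stF X Y m = stF X Y i * stF (X * stF X Y i ^ 2) (Y * stG X Y i ^ 2) j ∧
    stG X Y m = stG X Y i * stG (X * stF X Y i ^ 2) (Y * stG X Y i ^ 2) j := by
  have hX' : (0:ℝ) < X := by exact_mod_cast hX
  have hY' : (0:ℝ) < Y := by exact_mod_cast hY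
  set α : ℂ := ((Real.sqrt X : ℝ) : ℂ) with hα
  set β : ℂ := ((Real.sqrt Y : ℝ) : ℂ) * Complex.I with hβ
  have hα2 : α ^ 2 = X := by
    rw [hα, ← Complex.ofReal_pow, Real.sq_sqrt hX'.le]; simp
  have hβ2 : β ^ 2 = -Y := by
    rw [hβ, mul_pow, ← Complex.ofReal_pow, Real.sq_sqrt hY'.le]; simp
  have e1 := st_pow X Y α β hα2 hβ2 m
  have e2 := st_pow X Y α β hα2 hβ2 i
  have e3 := st_pow (X * stF X Y i ^ 2) (Y * stG X Y i ^ 2) (α * stF X Y i) (β * stG X Y i)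
    (by rw [mul_pow, hα2]; push_cast; ring) (by rw [mul_pow, hβ2]; push_cast; ring) j
  rw [← e2, ← pow_mul, ← h, e1] at e3
  have r := congrArg Complex.re e3
  have s := congrArg Complex.im e3
  have c1 : ∀ z : ℤ, ((z:ℂ)).re = z := fun z => by simp
  have c2 : ∀ z : ℤ, ((z:ℂ)).im = 0 := fun z => by simp
  simp [hα, hβ, Complex.add_re, Complex.add_im, Complex.mul_re, Complex.mul_im, c1, c2] at r s
  have sx : Real.sqrt X ≠ 0 := (Real.sqrt_pos.2 hX').ne'
  have sy : Real.sqrt Y ≠ 0 := (Real.sqrt_pos.2 hY').ne'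
  constructor
  · have : Real.sqrt X * (stF X Y m : ℝ) = Real.sqrt X * ((stF X Y i * stF (X * stF X Y i ^ 2) (Y * stG X Y i ^ 2) j : ℤ) : ℝ) := by
      push_cast; linarith
    exact_mod_cast mul_left_cancel₀ sx this
  · have : Real.sqrt Y * (stG X Y m : ℝ) = Real.sqrt Y * ((stG X Y i * stG (X * stF X Y i ^ 2) (Y * stG X Y i ^ 2) j : ℤ) : ℝ) := by
      push_cast; linarith
    exact_mod_cast mul_left_cancel₀ sy this

lemma st_modX (X Y : ℤ) (m : ℕ) :
    ∃ r s : ℤ, stF X Y m = (2 * m + 1) * (-Y) ^ m + X * r ∧ stG X Y m = (-Y) ^ m + X * s := by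
  induction m with
  | zero => exact ⟨0, 0, by simp [stF_zero], by simp [stG_zero]⟩
  | succ m ih =>
    obtain ⟨r, s, h1, h2⟩ := ih
    refine ⟨stF X Y m - Y * r - 2 * Y * s, stG X Y m - Y * s + 2 * stF X Y m, ?_, ?_⟩
    · rw [stF_succ, sub_mul]; nth_rw 2 [h1]; rw [h2]; push_cast; ring
    · rw [stG_succ, sub_mul]; nth_rw 2 [h2]; ring

lemma st_modX2 (X Y : ℤ) (m : ℕ) :
    ∃ r s : ℤ, 3 * stF X Y (m+1) = 3 * (2 * m + 3) * (-Y) ^ (m+1)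
        + (2 * m + 3) * (m + 1) * (2 * m + 1) * (-Y) ^ m * X + X ^ 2 * r ∧
      stG X Y (m+1) = (-Y) ^ (m+1) + (m+1) * (2 * m + 3) * (-Y) ^ m * X + X ^ 2 * s := by
  induction m with
  | zero => exact ⟨0, 0, by simp [stF_zero, stG_zero, stF_succ]; ring,
      by simp [stF_zero, stG_zero, stG_succ]; ring⟩
  | succ m ih =>
    obtain ⟨r, s, h1, h2⟩ := ih
    obtain ⟨r', s', h3, h4⟩ := st_modX X Y (m+1)
    refine ⟨3 * r' - Y * r - 6 * Y * s, s' - Y * s + 2 * r', ?_, ?_⟩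
    · rw [stF_succ, mul_sub, sub_mul, mul_sub]
      rw [show 3 * (Y * stF X Y (m+1)) = Y * (3 * stF X Y (m+1)) by ring, h1, h3, h2]
      push_cast; ring
    · rw [stG_succ, sub_mul]
      rw [show Y * stG X Y (m+1) = Y * ((-Y) ^ (m+1) + (m+1) * (2 * m + 3) * (-Y) ^ m * X + X ^ 2 * s) by rw [h2], h4, h3]
      push_cast; ring

/-- every prime divisor of `u` divides `v` -/
def stRad (u v : ℤ) : Prop := ∀ l : ℕ, l.Prime → (l : ℤ) ∣ u → (l : ℤ) ∣ v

lemma st_natAbs_prime_pow {n : ℤ} (hn : n ≠ 0) (p : ℕ)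
    (h : ∀ l : ℕ, l.Prime → (l : ℤ) ∣ n → l = p) : ∃ k, n.natAbs = p ^ k := by
  refine ⟨_, Nat.eq_prime_pow_of_unique_prime_dvd (p := p) (by simpa using hn) ?_⟩
  intro d hd hdn
  exact h d hd (Int.natCast_dvd.2 hdn)

lemma st_coprime_prime {X Y : ℤ} (h : IsCoprime X Y) {l : ℕ} (hl : l.Prime)
    (h1 : (l : ℤ) ∣ X) (h2 : (l : ℤ) ∣ Y) : False := by
  have := h.isUnit_of_dvd' h1 h2
  have h3 := Int.isUnit_iff.1 this
  have := hl.two_le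
  omega

lemma st_F_ne {X Y F : ℤ} (hY : 2 ≤ Y) (hco : IsCoprime X Y) (hF : stRad F X) : F ≠ 0 := by
  rintro rfl
  obtain ⟨l, hl, hlY⟩ := Nat.exists_prime_and_dvd (n := Y.natAbs) (by omega)
  exact st_coprime_prime hco hl (hF l hl (dvd_zero _)) (Int.natCast_dvd.2 hlY)

lemma st_F_bound {X Y : ℤ} (hX : 2 ≤ X) (hY : 2 ≤ Y) (hco : IsCoprime X Y) (m : ℕ) {p : ℕ}
    (hp : p.Prime) (hpm : p = 2 * m + 1) (h5 : 5 ≤ p) (hF : stRad (stF X Y m) X) :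
    (stF X Y m) ^ 2 ≤ (p : ℤ) ^ 2 := by
  have hF0 := st_F_ne hY hco hF
  have hall : ∀ l : ℕ, l.Prime → (l : ℤ) ∣ stF X Y m → l = p := by
    intro l hl hlF
    have hlX := hF l hl hlF
    obtain ⟨r, s, h1, -⟩ := st_modX X Y m
    have : (l : ℤ) ∣ (2 * m + 1) * (-Y) ^ m := by
      rw [show (2 * (m:ℤ) + 1) * (-Y) ^ m = stF X Y m - X * r by rw [h1]; ring]
      exact dvd_sub hlF (hlX.mul_right r)
    rcases (Nat.prime_iff_prime_int.1 hl).dvd_or_dvd this with h | h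
    · have : (l : ℤ) ∣ (p : ℤ) := by rw [hpm]; push_cast; exact h
      exact (Nat.prime_dvd_prime_iff_eq hl hp).1 (by exact_mod_cast this)
    · have := (Nat.prime_iff_prime_int.1 hl).dvd_of_dvd_pow h
      exact (st_coprime_prime hco hl hlX ((dvd_neg).1 this)).elim
  obtain ⟨k, hk⟩ := st_natAbs_prime_pow hF0 p hall
  have hk1 : k ≤ 1 := by
    by_contra hk2
    have hp2 : (p : ℤ) ^ 2 ∣ stF X Y m := by
      have : p ^ 2 ∣ (stF X Y m).natAbs := hk ▸ pow_dvd_pow p (by omega)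
      have := Int.natCast_dvd.2 this
      exact_mod_cast this
    have hpX : (p : ℤ) ∣ X := hF p hp ((dvd_pow_self _ two_ne_zero).trans hp2)
    obtain ⟨n, rfl⟩ : ∃ n, m = n + 1 := ⟨m - 1, by omega⟩
    obtain ⟨r, s, h1, -⟩ := st_modX2 X Y n
    have hpn : (p : ℤ) = 2 * n + 3 := by rw [hpm]; push_cast; ring
    rw [← hpn] at h1
    obtain ⟨w, hw⟩ := hpX
    have : (p : ℤ) ^ 2 ∣ 3 * p * (-Y) ^ (n+1) := by
      have e : 3 * (p:ℤ) * (-Y) ^ (n+1) = 3 * stF X Y (n+1) - p ^ 2 * ((n + 1) * (2 * n + 1) * (-Y) ^ n * w + w ^ 2 * r) := by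
        rw [h1]; rw [hw]; ring
      rw [e]
      exact dvd_sub (hp2.mul_left 3) (dvd_mul_right _ _)
    rw [show 3 * (p:ℤ) * (-Y) ^ (n+1) = p * (3 * (-Y)^(n+1)) by ring, sq] at this
    have hp0 : (p:ℤ) ≠ 0 := by exact_mod_cast hp.ne_zero
    have := (mul_dvd_mul_iff_left hp0).1 this
    rcases (Nat.prime_iff_prime_int.1 hp).dvd_or_dvd this with h | h
    · have := Int.le_of_dvd (by norm_num) h
      omega
    · have := (Nat.prime_iff_prime_int.1 hp).dvd_of_dvd_pow h
      exact st_coprime_prime hco hp ⟨w, hw⟩ ((dvd_neg).1 this)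
  have : (stF X Y m).natAbs ≤ p := by
    rw [hk]; calc p ^ k ≤ p ^ 1 := Nat.pow_le_pow_right hp.pos hk1
      _ = p := pow_one p
  rw [← Int.natAbs_sq (stF X Y m)]
  have h' : ((stF X Y m).natAbs : ℤ) ≤ p := by exact_mod_cast this
  exact pow_le_pow_left₀ (by positivity) h' 2

lemma st_rad_swap {X Y : ℤ} {m : ℕ} (hG : stRad (stG X Y m) Y) : stRad (stF Y X m) Y := by
  intro l hl h
  apply hG l hl
  rw [(stG_swap X Y m).1]
  exact h.mul_left _

lemma st_five {p : ℕ} (h : 5 ≤ p) : p ^ 2 < 5 ^ (p - 1) := by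
  induction p, h using Nat.le_induction with
  | base => norm_num
  | succ n hn ih =>
    obtain ⟨k, rfl⟩ : ∃ k, n = k + 1 := ⟨n - 1, by omega⟩
    simp only [Nat.add_sub_cancel] at *
    rw [pow_succ 5]; nlinarith

lemma st_E1 {X Y : ℤ} (hX : 2 ≤ X) (hY : 2 ≤ Y) (hco : IsCoprime X Y) (m : ℕ) {p : ℕ}
    (hp : p.Prime) (hpm : p = 2 * m + 1) (h5 : 5 ≤ p) (hF : stRad (stF X Y m) X)
    (hG : stRad (stG X Y m) Y) : False := by
  have b1 := st_F_bound hX hY hco m hp hpm h5 hF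
  have b2 := st_F_bound hY hX hco.symm m hp hpm h5 (st_rad_swap hG)
  have b3 : (stG X Y m) ^ 2 ≤ (p:ℤ) ^ 2 := by
    rw [(stG_swap X Y m).1, mul_pow, ← pow_mul, mul_comm m 2, pow_mul]; simpa using b2
  have hn := st_norm X Y m
  have hXY : 5 ≤ X + Y := by
    by_contra hh
    have h1 : X = 2 := by omega
    have h2 : Y = 2 := by omega
    subst h1 h2
    exact st_coprime_prime hco Nat.prime_two (by norm_num) (by norm_num)
  have h4 : (X + Y) ^ (2 * m + 1) ≤ (p:ℤ)^2 * (X + Y) := by rw [← hn]; nlinarith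
  rw [pow_succ] at h4
  have h6 : (X + Y) ^ (2 * m) ≤ (p:ℤ)^2 := le_of_mul_le_mul_right h4 (by omega)
  have h7 : (5:ℤ) ^ (2 * m) ≤ (X+Y) ^ (2 * m) := pow_le_pow_left₀ (by norm_num) hXY _
  have h8 := st_five h5
  rw [hpm, Nat.add_sub_cancel] at h8
  rw [hpm] at h6
  have h9 : ((2 * m + 1 : ℕ) : ℤ) ^ 2 < 5 ^ (2 * m) := by exact_mod_cast h8
  omega

def stSpecial (X Y : ℤ) : Prop := (3:ℤ) ∣ X ∧ ¬ (9:ℤ) ∣ X ∧ Y = 3 * X + 1 ∧ ∃ k : ℕ, 1 ≤ k ∧ X - 3 * Y = -3 ^ k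

lemma stF_one (X Y : ℤ) : stF X Y 1 = X - 3 * Y := by
  rw [show (1:ℕ) = 0 + 1 from rfl, stF_succ, stF_zero, stG_zero]; ring
lemma stG_one (X Y : ℤ) : stG X Y 1 = 3 * X - Y := by
  rw [show (1:ℕ) = 0 + 1 from rfl, stG_succ, stF_zero, stG_zero]; ring

lemma st_pow3 {X Y : ℤ} (hY : 2 ≤ Y) (hco : IsCoprime X Y) (h : stRad (X - 3 * Y) X) :
    ∃ k, (X - 3 * Y).natAbs = 3 ^ k := by
  refine st_natAbs_prime_pow (st_F_ne hY hco h) 3 ?_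
  intro l hl hd
  have h1 := h l hl hd
  have h2 : (l:ℤ) ∣ 3 * Y := by
    have := dvd_sub h1 hd; simpa using this
  rcases (Nat.prime_iff_prime_int.1 hl).dvd_or_dvd h2 with h3 | h3
  · exact (Nat.prime_dvd_prime_iff_eq hl Nat.prime_three).1 (by exact_mod_cast h3)
  · exact (st_coprime_prime hco hl h1 h3).elim

lemma st_special_aux {X Y : ℤ} (hX : 2 ≤ X) (hY : 2 ≤ Y) (k : ℕ)
    (hk : (X - 3 * Y).natAbs = 3 ^ k) (h1 : (3 * X - Y).natAbs = 1) (h3 : (3:ℤ) ∣ X) :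
    stSpecial X Y := by
  have hk' : 8 * X - 3 * (3 * X - Y) = 3 ^ k := by
    zify at hk
    have hneg : X - 3 * Y ≤ 0 := by omega
    rw [abs_of_nonpos hneg] at hk
    linarith
  have h9 : ∀ k : ℕ, (3:ℤ)^k % 8 = 1 ∨ (3:ℤ)^k % 8 = 3 := by
    intro k; induction k with
    | zero => simp
    | succ k ih => rw [pow_succ]; omega
  have hk2 : 2 ≤ k := by
    by_contra hh
    have : k = 0 ∨ k = 1 := by omega
    rcases this with rfl | rfl <;> omega
  obtain ⟨j, rfl⟩ : ∃ j, k = j + 2 := ⟨k - 2, by omega⟩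
  obtain ⟨w, rfl⟩ := h3
  have e : (3:ℤ)^(j+2) = 9 * 3^j := by ring
  have := h9 (j+1)
  have e' : (3:ℤ)^(j+1) = 3 * 3^j := by ring
  rw [e'] at this
  have hs : 3 * (3 * w) - Y = 1 ∨ 3 * (3 * w) - Y = -1 := by omega
  rw [e] at hk'
  have hs' : 3 * (3 * w) - Y = -1 := by omega
  refine ⟨⟨w, rfl⟩, by omega, by omega, j+2, by omega, by rw [e]; omega⟩

lemma st_E3 {X Y : ℤ} (hX : 2 ≤ X) (hY : 2 ≤ Y) (hco : IsCoprime X Y) 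
    (hF : stRad (stF X Y 1) X) (hG : stRad (stG X Y 1) Y) : stSpecial X Y ∨ stSpecial Y X := by
  have hG' := st_rad_swap hG
  rw [stF_one] at hF hG'
  obtain ⟨k, hk⟩ := st_pow3 hY hco hF
  obtain ⟨l, hl⟩ := st_pow3 hX hco.symm hG'
  have d1 : k ≠ 0 → (3:ℤ) ∣ X := by
    intro h
    exact hF 3 Nat.prime_three (Int.natCast_dvd.2 (hk ▸ dvd_pow_self 3 h))
  have d2 : l ≠ 0 → (3:ℤ) ∣ Y := by
    intro h
    exact hG' 3 Nat.prime_three (Int.natCast_dvd.2 (hl ▸ dvd_pow_self 3 h))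
  by_cases hk0 : k = 0
  · by_cases hl0 : l = 0
    · subst hk0 hl0
      simp only [pow_zero] at hk hl
      have : X = Y := by omega
      subst this; omega
    · right
      subst hk0
      exact st_special_aux hY hX l hl (by simp only [pow_zero] at hk; omega) (d2 hl0)
  · by_cases hl0 : l = 0
    · left
      subst hl0
      exact st_special_aux hX hY k hk (by simp only [pow_zero] at hl; omega) (d1 hk0)
    · exact (st_coprime_prime hco Nat.prime_three (d1 hk0) (d2 hl0)).elim

lemma st_H_sub {X Y : ℤ} (hX : 2 ≤ X) (hY : 2 ≤ Y) (i j m : ℕ)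
    (h : 2 * m + 1 = (2 * i + 1) * (2 * j + 1))
    (hF : stRad (stF X Y m) X) (hG : stRad (stG X Y m) Y) :
    stRad (stF X Y i) X ∧ stRad (stG X Y i) Y ∧
    stRad (stF (X * stF X Y i ^ 2) (Y * stG X Y i ^ 2) j) (X * stF X Y i ^ 2) ∧
    stRad (stG (X * stF X Y i ^ 2) (Y * stG X Y i ^ 2) j) (Y * stG X Y i ^ 2) := by
  obtain ⟨h1, h2⟩ := st_comp X Y (by omega) (by omega) i j m h
  refine ⟨fun l hl hd => hF l hl ?_, fun l hl hd => hG l hl ?_, 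
    fun l hl hd => (hF l hl ?_).mul_right _, fun l hl hd => (hG l hl ?_).mul_right _⟩
  · rw [h1]; exact hd.mul_right _
  · rw [h2]; exact hd.mul_right _
  · rw [h1]; exact hd.mul_left _
  · rw [h2]; exact hd.mul_left _

lemma st_odd_factor {m p : ℕ} (h : p ∣ 2 * m + 1) :
    ∃ i j, p = 2 * i + 1 ∧ 2 * m + 1 = (2 * i + 1) * (2 * j + 1) := by
  obtain ⟨q, hq⟩ := h
  have hodd : Odd (p * q) := hq ▸ ⟨m, rfl⟩
  obtain ⟨⟨i, hi⟩, ⟨j, hj⟩⟩ := Nat.odd_mul.1 hodd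
  exact ⟨i, j, hi, by rw [hq, hi, hj]⟩

/-- the key lemma -/
lemma st_E {X Y : ℤ} (hX : 2 ≤ X) (hY : 2 ≤ Y) (hco : IsCoprime X Y) (m : ℕ) (hm : m ≠ 0)
    (hF : stRad (stF X Y m) X) (hG : stRad (stG X Y m) Y) : 
    m = 1 ∧ (stSpecial X Y ∨ stSpecial Y X) := by
  have key : ∀ X Y : ℤ, 2 ≤ X → 2 ≤ Y → IsCoprime X Y → ∀ m : ℕ, m ≠ 0 → 
      stRad (stF X Y m) X → stRad (stG X Y m) Y → 3 ∣ 2 * m + 1 := by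
    intro X Y hX hY hco m hm hF hG
    obtain ⟨p, hp, hpd⟩ := Nat.exists_prime_and_dvd (n := 2 * m + 1) (by omega)
    obtain ⟨i, j, hi, hij⟩ := st_odd_factor hpd
    obtain ⟨h1, h2, -, -⟩ := st_H_sub hX hY i j m hij hF hG
    by_cases h5 : 5 ≤ p
    · exact (st_E1 hX hY hco i hp hi h5 h1 h2).elim
    · have := hp.two_le
      have : p = 3 := by omega
      exact this ▸ hpd
  have spec : ∀ X Y : ℤ, 2 ≤ X → 2 ≤ Y → IsCoprime X Y → ∀ m : ℕ, 3 ∣ 2 * m + 1 → 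
      stRad (stF X Y m) X → stRad (stG X Y m) Y → stSpecial X Y ∨ stSpecial Y X := by
    intro X Y hX hY hco m hm hF hG
    obtain ⟨i, j, hi, hij⟩ := st_odd_factor hm
    obtain rfl : i = 1 := by omega
    obtain ⟨h1, h2, -, -⟩ := st_H_sub hX hY 1 j m hij hF hG
    exact st_E3 hX hY hco h1 h2
  have h3 := key X Y hX hY hco m hm hF hG
  have hs := spec X Y hX hY hco m h3 hF hG
  refine ⟨?_, hs⟩
  by_contra hm1
  obtain ⟨i, j, hi, hij⟩ := st_odd_factor h3
  obtain rfl : i = 1 := by omega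
  obtain ⟨h1, h2, h4, h5⟩ := st_H_sub hX hY 1 j m hij hF hG
  have f0 := st_F_ne hY hco h1
  have g0 := st_F_ne hX hco.symm h2
  have hX' : 2 ≤ X * stF X Y 1 ^ 2 := by
    have : 0 < stF X Y 1 ^ 2 := by positivity
    nlinarith
  have hY' : 2 ≤ Y * stG X Y 1 ^ 2 := by
    have : 0 < stG X Y 1 ^ 2 := by positivity
    nlinarith
  have rX : ∀ l : ℕ, l.Prime → (l:ℤ) ∣ X * stF X Y 1 ^ 2 → (l:ℤ) ∣ X := by
    intro l hl hd
    rcases (Nat.prime_iff_prime_int.1 hl).dvd_or_dvd hd with h | h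
    · exact h
    · exact h1 l hl ((Nat.prime_iff_prime_int.1 hl).dvd_of_dvd_pow h)
  have rY : ∀ l : ℕ, l.Prime → (l:ℤ) ∣ Y * stG X Y 1 ^ 2 → (l:ℤ) ∣ Y := by
    intro l hl hd
    rcases (Nat.prime_iff_prime_int.1 hl).dvd_or_dvd hd with h | h
    · exact h
    · exact h2 l hl ((Nat.prime_iff_prime_int.1 hl).dvd_of_dvd_pow h)
  have hco' : IsCoprime (X * stF X Y 1 ^ 2) (Y * stG X Y 1 ^ 2) := by
    rw [Int.isCoprime_iff_gcd_eq_one]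
    refine Nat.eq_one_iff_not_exists_prime_dvd.2 ?_ 
    intro l hl hd
    have hd' : (l:ℤ) ∣ Int.gcd (X * stF X Y 1 ^ 2) (Y * stG X Y 1 ^ 2) := by exact_mod_cast hd
    exact st_coprime_prime hco hl (rX l hl (hd'.trans (Int.gcd_dvd_left ..))) (rY l hl (hd'.trans (Int.gcd_dvd_right ..)))
  have hj : j ≠ 0 := by omega
  have h3j := key _ _ hX' hY' hco' j hj h4 h5
  have hs' := spec _ _ hX' hY' hco' j h3j h4 h5
  have nine : ∀ X Y, stSpecial X Y → (9:ℤ) ∣ X * (X - 3 * Y)^2 := by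
    rintro X Y ⟨-, -, -, k, hk, e⟩
    rw [e]
    obtain ⟨n, rfl⟩ : ∃ n, k = n + 1 := ⟨k-1, by omega⟩
    exact ⟨X * (3^n)^2, by ring⟩
  rw [stF_one, stG_one] at *
  rcases hs with hs | hs
  · rcases hs' with hs' | hs'
    · exact hs'.2.1 (nine X Y hs)
    · exact st_coprime_prime hco Nat.prime_three hs.1 (rY 3 Nat.prime_three hs'.1)
  · rcases hs' with hs' | hs'
    · exact st_coprime_prime hco Nat.prime_three (rX 3 Nat.prime_three hs'.1) hs.1
    · apply hs'.2.1
      have := nine Y X hs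
      rwa [show (3 * X - Y)^2 = (Y - 3 * X)^2 by ring]


structure stCtx (A B c t a b : ℤ) : Prop where
  hA : 0 < A
  hB : 0 < B
  hc : 1 < c
  c2 : IsCoprime 2 c
  cA : IsCoprime A c
  cB : IsCoprime B c
  ca : IsCoprime a c
  cb : IsCoprime b c
  ct : IsCoprime t c
  ht : c ∣ A + B * t ^ 2
  ha : 1 < a
  hb : 1 < b

structure stGood (A B c t a b u v : ℤ) (z : ℕ) : Prop where
  norm : A * u ^ 2 + B * v ^ 2 = c ^ z
  comp : c ∣ v - t * u
  cop : IsCoprime u c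
  ra : stRad a (A * u)
  rb : stRad b (B * v)

lemma st_cop_congr {x y c : ℤ} (h : IsCoprime x c) (hd : c ∣ x - y) : IsCoprime y c := by
  obtain ⟨k, hk⟩ := hd
  have : y = x + c * (-k) := by linarith
  rw [this]; exact IsCoprime.add_mul_left_left h (-k)

lemma stGood.copv {A B c t a b u v : ℤ} {z : ℕ} (C : stCtx A B c t a b)
    (h : stGood A B c t a b u v z) : IsCoprime v c :=
  st_cop_congr (C.ct.mul_left h.cop) (by rw [dvd_sub_comm]; exact h.comp)

lemma st_compat {A B c t a b : ℤ} (C : stCtx A B c t a b) {u v : ℤ}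
    (h : c ∣ A * u ^ 2 + B * v ^ 2) (hu : IsCoprime (v + t * u) c) :
    c ∣ v - t * u ∧ IsCoprime u c := by
  have h1 : c ∣ (B * (v + t * u)) * (v - t * u) := by
    rw [show (B * (v + t * u)) * (v - t * u) = (A * u ^ 2 + B * v ^ 2) - (A + B * t ^ 2) * u ^ 2 by ring]
    exact dvd_sub h (C.ht.mul_right _)
  have h2 : c ∣ v - t * u := (IsCoprime.symm (C.cB.mul_left hu)).dvd_of_dvd_mul_left h1
  refine ⟨h2, ?_⟩
  have h3 : IsCoprime (2 * t * u) c := by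
    refine st_cop_congr hu ?_
    rw [show v + t * u - 2 * t * u = v - t * u by ring]; exact h2
  exact h3.of_mul_left_right

lemma st_dvd_of_sq {c A V : ℤ} {r : ℕ} (cA : IsCoprime A c) (h : c ^ (2 * r) ∣ A * V ^ 2) :
    c ^ r ∣ V := by
  have h1 : c ^ (2 * r) ∣ V ^ 2 := (IsCoprime.pow_left cA.symm).dvd_of_dvd_mul_left h
  rw [mul_comm, pow_mul] at h1
  exact (Int.pow_dvd_pow_iff two_ne_zero).1 h1

lemma st_div {A B c t a b : ℤ} (C : stCtx A B c t a b) {u v u0 v0 : ℤ} {z z0 : ℕ}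
    (h : stGood A B c t a b u v z) (h0 : stGood A B c t a b u0 v0 z0) (hz : z0 ≤ z) :
    ∃ p q : ℤ, u = u0 * p - B * v0 * q ∧ v = v0 * p + A * u0 * q ∧
      c ^ z0 * q = v * u0 - u * v0 ∧ p ^ 2 + A * B * q ^ 2 = c ^ (z - z0) := by
  have hc0 : c ^ z0 ≠ 0 := pow_ne_zero _ (by have := C.hc; omega)
  obtain ⟨w, rfl⟩ : ∃ w, z = z0 + w := ⟨z - z0, by omega⟩
  have n := h.norm
  have n0 := h0.norm
  rw [pow_add] at n
  have cp : IsCoprime (A * (u * v0 + v * u0)) c := by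
    refine C.cA.mul_left ?_
    refine st_cop_congr ((C.c2.mul_left C.ct).mul_left (h.cop.mul_left h0.cop)) ?_
    obtain ⟨k, hk⟩ := h.comp
    obtain ⟨k0, hk0⟩ := h0.comp
    have e1 : v = t * u + c * k := by linarith
    have e2 : v0 = t * u0 + c * k0 := by linarith
    exact ⟨-(u * k0 + k * u0), by rw [e1, e2]; ring⟩
  have dQ : c ^ z0 ∣ v * u0 - u * v0 := by
    have : c ^ z0 ∣ (A * (u * v0 + v * u0)) * (v * u0 - u * v0) := by
      refine ⟨v ^ 2 - v0 ^ 2 * c ^ w, ?_⟩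
      linear_combination v0 ^ 2 * (-n) + v ^ 2 * n0
    exact (IsCoprime.pow_left cp.symm).dvd_of_dvd_mul_left this
  obtain ⟨q, hq⟩ := dQ
  have nPQ : (A * u * u0 + B * v * v0) ^ 2 + A * B * (v * u0 - u * v0) ^ 2 = c ^ z0 * c ^ w * c ^ z0 := by
    rw [← n]; nth_rw 1 [← n0]; ring
  have dP : c ^ z0 ∣ A * u * u0 + B * v * v0 := by
    refine st_dvd_of_sq (A := 1) isCoprime_one_left ?_
    refine ⟨c ^ w - A * B * q ^ 2, ?_⟩
    rw [hq] at nPQ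
    rw [mul_comm 2, pow_mul]
    linear_combination nPQ
  obtain ⟨p, hp⟩ := dP
  refine ⟨p, q, ?_, ?_, hq.symm, ?_⟩
  · apply mul_left_cancel₀ hc0
    linear_combination u0 * hp - B * v0 * hq - u * n0
  · apply mul_left_cancel₀ hc0
    linear_combination v0 * hp + A * u0 * hq - v * n0
  · rw [hp, hq] at nPQ
    rw [Nat.add_sub_cancel_left]
    apply mul_left_cancel₀ hc0; apply mul_left_cancel₀ hc0
    linear_combination nPQ

lemma st_prime_ndvd {a c : ℤ} (h : IsCoprime a c) {l : ℕ} (hl : l.Prime) (hla : (l:ℤ) ∣ a) {n : ℕ} {x : ℤ}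
    (hd : (l : ℤ) ∣ c ^ n * x) : (l:ℤ) ∣ x := by
  rcases (Nat.prime_iff_prime_int.1 hl).dvd_or_dvd hd with h1 | h1
  · exact (st_coprime_prime h hl hla ((Nat.prime_iff_prime_int.1 hl).dvd_of_dvd_pow h1)).elim
  · exact h1

lemma st_div2 {A B c t a b : ℤ} (C : stCtx A B c t a b) {u v u0 v0 : ℤ} {z z0 r : ℕ}
    (h : stGood A B c t a b u v z) (h0 : stGood A B c t a b u0 v0 z0) (hz : z0 ≤ z)
    (hr1 : r ≤ z0) (hr2 : r ≤ z - z0) :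
    ∃ p q u' v' : ℤ, u = u0 * p - B * v0 * q ∧ v = v0 * p + A * u0 * q ∧
      p ^ 2 + A * B * q ^ 2 = c ^ (z - z0) ∧ c ^ r * u' = p * u0 + B * q * v0 ∧
      c ^ r * v' = A * q * u0 - p * v0 ∧ A * u' ^ 2 + B * v' ^ 2 = c ^ (z - 2 * r) ∧
      stRad a (A * u') ∧ stRad b (B * v') := by
  obtain ⟨p, q, e1, e2, e3, e4⟩ := st_div C h h0 hz
  have hc0 : c ^ r ≠ 0 := pow_ne_zero _ (by have := C.hc; omega)
  have n := h.norm
  have n0 := h0.norm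
  have dW : c ^ r ∣ A * q * u0 - p * v0 := by
    have : c ^ r ∣ (B * v) * (A * q * u0 - p * v0) := by
      have : (B * v) * (A * q * u0 - p * v0) = c ^ (z - z0) * (A * u0 ^ 2) - c ^ z0 * p ^ 2 := by
        rw [e2]; linear_combination A * u0 ^ 2 * e4 - p ^ 2 * n0
      rw [this]
      exact dvd_sub ((pow_dvd_pow c hr2).mul_right _) ((pow_dvd_pow c hr1).mul_right _)
    exact (IsCoprime.pow_left (C.cB.mul_left (h.copv C)).symm).dvd_of_dvd_mul_left this
  obtain ⟨v', hv'⟩ := dW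
  have nVW : A * (p * u0 + B * q * v0) ^ 2 + B * (A * q * u0 - p * v0) ^ 2 = c ^ (2 * r) * c ^ (z - 2 * r) := by
    rw [← pow_add, show 2 * r + (z - 2 * r) = z - z0 + z0 by omega, pow_add, ← n0, ← e4]; ring
  have dV : c ^ r ∣ p * u0 + B * q * v0 := by
    refine st_dvd_of_sq C.cA ⟨c ^ (z - 2 * r) - B * v' ^ 2, ?_⟩
    rw [hv', mul_comm 2, pow_mul] at nVW
    rw [mul_comm 2, pow_mul]
    linear_combination nVW
  obtain ⟨u', hu'⟩ := dV
  refine ⟨p, q, u', v', e1, e2, e4, hu'.symm, hv'.symm, ?_, ?_, ?_⟩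
  · rw [hu', hv', show c ^ (2 * r) = (c ^ r) ^ 2 by ring] at nVW
    apply mul_left_cancel₀ hc0; apply mul_left_cancel₀ hc0
    linear_combination nVW
  · intro l hl hla
    have pl := Nat.prime_iff_prime_int.1 hl
    by_cases hA : (l:ℤ) ∣ A
    · exact hA.mul_right _
    have hu := (pl.dvd_or_dvd (h.ra l hl hla)).resolve_left hA
    have hu0 := (pl.dvd_or_dvd (h0.ra l hl hla)).resolve_left hA
    have hq : (l:ℤ) ∣ q := st_prime_ndvd C.ca hl hla (e3 ▸ dvd_sub (hu0.mul_left _) (hu.mul_right _))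
    refine Dvd.dvd.mul_left (st_prime_ndvd C.ca hl hla (n := r) ?_) _
    rw [← hu']
    exact dvd_add (hu0.mul_left _) ((hq.mul_left _).mul_right _)
  · intro l hl hla
    have pl := Nat.prime_iff_prime_int.1 hl
    by_cases hA : (l:ℤ) ∣ B
    · exact hA.mul_right _
    have hu := (pl.dvd_or_dvd (h.rb l hl hla)).resolve_left hA
    have hu0 := (pl.dvd_or_dvd (h0.rb l hl hla)).resolve_left hA
    have hq : (l:ℤ) ∣ q := st_prime_ndvd C.cb hl hla (e3 ▸ dvd_sub (hu.mul_right _) (hu0.mul_left _))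
    refine Dvd.dvd.mul_left (st_prime_ndvd C.cb hl hla (n := r) ?_) _
    rw [← hv']
    exact dvd_sub ((hq.mul_left _).mul_right _) (hu0.mul_left _)

lemma st_no_zero {A B c t a b : ℤ} (C : stCtx A B c t a b) {u v : ℤ} (h : A * u ^ 2 + B * v ^ 2 = 1)
    (ra : stRad a (A * u)) (rb : stRad b (B * v)) : False := by
  obtain ⟨l, hl, hla⟩ := Nat.exists_prime_and_dvd (n := a.natAbs) (by have := C.ha; omega)
  obtain ⟨k, hk, hkb⟩ := Nat.exists_prime_and_dvd (n := b.natAbs) (by have := C.hb; omega)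
  have h1 : (l:ℤ) ∣ A * u ^ 2 := by
    have := ra l hl (Int.natCast_dvd.2 hla); rw [sq, ← mul_assoc]; exact this.mul_right _
  have h2 : (k:ℤ) ∣ B * v ^ 2 := by
    have := rb k hk (Int.natCast_dvd.2 hkb); rw [sq, ← mul_assoc]; exact this.mul_right _
  have p1 : 0 ≤ A * u ^ 2 := mul_nonneg C.hA.le (sq_nonneg _)
  have p2 : 0 ≤ B * v ^ 2 := mul_nonneg C.hB.le (sq_nonneg _)
  have := hl.two_le
  have := hk.two_le
  rcases eq_or_lt_of_le p1 with e | e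
  · have : B * v ^ 2 = 1 := by omega
    rw [this] at h2
    have := Int.le_of_dvd one_pos h2
    omega
  · have : A * u ^ 2 = 1 := by omega
    rw [this] at h1
    have := Int.le_of_dvd one_pos h1
    omega

lemma st_c_dvd {A B c t a b : ℤ} {u v : ℤ} {z : ℕ} (h : stGood A B c t a b u v z) (hz : 1 ≤ z) :
    c ∣ A * u ^ 2 + B * v ^ 2 := by rw [h.norm]; exact dvd_pow_self c (by omega)

lemma st_step1 {A B c t a b : ℤ} (C : stCtx A B c t a b) {u v u0 v0 : ℤ} {z z0 : ℕ}
    (h : stGood A B c t a b u v z) (h0 : stGood A B c t a b u0 v0 z0) (hz0 : 1 ≤ z0) (hz : 2 * z0 ≤ z) :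
    ∃ u' v', stGood A B c t a b u' v' (z - 2 * z0) ∧ 2 * z0 < z ∧
      u = u' * (A * u0 ^ 2 - B * v0 ^ 2) - 2 * B * u0 * v0 * v' ∧ 
      v = v' * (A * u0 ^ 2 - B * v0 ^ 2) + 2 * A * u0 * v0 * u' := by
  obtain ⟨p, q, u', v', e1, e2, e4, e5, e6, e7, ra, rb⟩ := st_div2 C h h0 (r := z0) (by omega) le_rfl (by omega)
  have hc0 : c ^ z0 ≠ 0 := pow_ne_zero _ (by have := C.hc; omega)
  have n0 := h0.norm
  have hp : p = A * u0 * u' - B * v0 * v' := by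
    apply mul_left_cancel₀ hc0
    linear_combination -A * u0 * e5 + B * v0 * e6 - p * n0
  have hq : q = v0 * u' + u0 * v' := by
    apply mul_left_cancel₀ hc0
    linear_combination -v0 * e5 - u0 * e6 - q * n0
  have eu : u = u' * (A * u0 ^ 2 - B * v0 ^ 2) - 2 * B * u0 * v0 * v' := by rw [e1, hp, hq]; ring
  have ev : v = v' * (A * u0 ^ 2 - B * v0 ^ 2) + 2 * A * u0 * v0 * u' := by rw [e2, hp, hq]; ring
  have hlt : 2 * z0 < z := by
    rcases eq_or_lt_of_le hz with e | e
    · rw [show z - 2 * z0 = 0 by omega, pow_zero] at e7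
      exact (st_no_zero C e7 ra rb).elim
    · exact e
  have cp : IsCoprime (v' + t * u') c := by
    have : IsCoprime (2 * A * u0 ^ 2 * (v' + t * u')) c := by
      refine st_cop_congr (C.ct.mul_left h.cop) ?_
      obtain ⟨k, hk⟩ := h0.comp
      obtain ⟨m, hm⟩ := C.ht
      obtain ⟨n, hn⟩ := st_c_dvd h0 hz0
      refine ⟨-t * u' * n - 2 * v' * u0 * (u0 * m + B * t * k), ?_⟩
      rw [eu]
      linear_combination (-t * u') * hn - 2 * v' * u0 * (u0 * hm + B * t * hk)
    exact this.of_mul_left_right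
  have := st_compat C (e7 ▸ dvd_pow_self c (by omega)) cp
  exact ⟨u', v', ⟨e7, this.1, this.2, ra, rb⟩, hlt, eu, ev⟩

lemma st_step2 {A B c t a b : ℤ} (C : stCtx A B c t a b) {u v u0 v0 : ℤ} {z z0 : ℕ}
    (h : stGood A B c t a b u v z) (h0 : stGood A B c t a b u0 v0 z0)
    (hz : z0 ≤ z) (hz2 : z < 2 * z0) :
    ∃ u' v', stGood A B c t a b u' v' (2 * z0 - z) := by
  obtain ⟨p, q, u', v', e1, e2, e4, e5, e6, e7, ra, rb⟩ := st_div2 C h h0 (r := z - z0) (by omega) (by omega) le_rfl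
  have hc0 : c ^ (z - z0) ≠ 0 := pow_ne_zero _ (by have := C.hc; omega)
  have hu0 : u0 = p * u' + B * q * v' := by
    apply mul_left_cancel₀ hc0
    linear_combination -p * e5 - B * q * e6 - u0 * e4
  have hv0 : v0 = -p * v' + A * q * u' := by
    apply mul_left_cancel₀ hc0
    linear_combination p * e6 - A * q * e5 - v0 * e4
  rw [show z - 2 * (z - z0) = 2 * z0 - z by omega] at e7
  have key : u * (-v') + v * u' = 2 * u0 * v0 := by
    rw [e1, e2]
    linear_combination (-u0) * hv0 - v0 * hu0
  have cp : IsCoprime (-v' + t * u') c := by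
    have : IsCoprime (u * (-v' + t * u')) c := by
      refine st_cop_congr ((C.c2.mul_left h0.cop).mul_left (h0.copv C)) ?_
      rw [← key]
      obtain ⟨k, hk⟩ := h.comp
      refine ⟨k * u', ?_⟩
      linear_combination u' * hk
    exact this.of_mul_left_right
  have e7' : A * u' ^ 2 + B * (-v') ^ 2 = c ^ (2 * z0 - z) := by rw [← e7]; ring
  have := st_compat C (e7' ▸ dvd_pow_self c (by omega)) cp
  exact ⟨u', -v', ⟨e7', this.1, this.2, ra, fun l hl hd => by
    rw [mul_neg]; exact (rb l hl hd).neg_right⟩⟩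

lemma st_step0 {A B c t a b : ℤ} (C : stCtx A B c t a b) {u v u0 v0 : ℤ} {z : ℕ}
    (h : stGood A B c t a b u v z) (h0 : stGood A B c t a b u0 v0 z) :
    ∃ e : ℤ, (e = 1 ∨ e = -1) ∧ u = e * u0 ∧ v = e * v0 := by
  obtain ⟨p, q, e1, e2, e3, e4⟩ := st_div C h h0 le_rfl
  rw [Nat.sub_self, pow_zero] at e4
  have hAB : 0 < A * B := mul_pos C.hA C.hB
  by_cases hq : q = 0
  · subst hq
    have : (p - 1) * (p + 1) = 0 := by linear_combination e4
    refine ⟨p, ?_, by rw [e1]; ring, by rw [e2]; ring⟩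
    rcases mul_eq_zero.1 this with h | h
    · left; omega
    · right; omega
  · exfalso
    have q1 : 1 ≤ q ^ 2 := by have : 0 < q ^ 2 := by positivity
                              omega
    have p0 : p = 0 := by
      by_contra hp
      have : 0 < p ^ 2 := by positivity
      nlinarith
    have AB1 : A * B = 1 := by
      have : A * B * q ^ 2 = 1 := by rw [← e4, p0]; ring
      nlinarith
    have B1 : B = 1 := by
      have := C.hA; have := C.hB; nlinarith
    have A1 : A = 1 := by rw [B1] at AB1; omega
    obtain ⟨l, hl, hla⟩ := Nat.exists_prime_and_dvd (n := a.natAbs) (by have := C.ha; omega)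
    have hla := Int.natCast_dvd.2 hla
    have h1 := h.ra l hl hla
    have h2 := h0.ra l hl hla
    rw [A1, one_mul] at h1 h2
    have q1' : q ^ 2 = 1 := by rw [AB1, p0] at e4; linarith
    have h3 : (l:ℤ) ∣ v0 := by
      rw [show v0 = -(q * u) by rw [e1, p0, B1]; linear_combination -v0 * q1']
      exact (h1.mul_left q).neg_right
    have h4 : (l:ℤ) ∣ c ^ z := by
      rw [← h0.norm, A1, B1, sq, sq]
      exact dvd_add ((h2.mul_left _).mul_left _) ((h3.mul_left _).mul_left _)
    exact st_coprime_prime C.ca hl hla ((Nat.prime_iff_prime_int.1 hl).dvd_of_dvd_pow h4)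

lemma st_all {A B c t a b : ℤ} (C : stCtx A B c t a b) {u0 v0 : ℤ} {z0 : ℕ} (hz0 : 1 ≤ z0)
    (h0 : stGood A B c t a b u0 v0 z0)
    (hmin : ∀ z u v, 1 ≤ z → stGood A B c t a b u v z → z0 ≤ z) (z : ℕ) :
    ∀ u v, 1 ≤ z → stGood A B c t a b u v z → ∃ (m : ℕ) (e : ℤ), (e = 1 ∨ e = -1) ∧ 
      z = (2 * m + 1) * z0 ∧
      u = e * (u0 * stF (A * u0 ^ 2) (B * v0 ^ 2) m) ∧ v = e * (v0 * stG (A * u0 ^ 2) (B * v0 ^ 2) m) := by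
  induction z using Nat.strong_induction_on with
  | _ z ih =>
  intro u v hz h
  have hz0z := hmin z u v hz h
  by_cases h2 : 2 * z0 ≤ z
  · obtain ⟨u', v', hg, hlt, eu, ev⟩ := st_step1 C h h0 hz0 h2
    obtain ⟨m, e, he, hz', hu', hv'⟩ := ih (z - 2 * z0) (by omega) u' v' (by omega) hg
    refine ⟨m + 1, e, he, ?_, ?_, ?_⟩
    · have : z = 2 * z0 + (z - 2 * z0) := by omega
      rw [this, hz']; ring
    · rw [eu, hu', hv', stF_succ]; ring
    · rw [ev, hu', hv', stG_succ]; ring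
  · obtain ⟨u', v', hg⟩ := st_step2 C h h0 hz0z (by omega)
    have := hmin _ u' v' (by omega) hg
    have hzz : z = z0 := by omega
    subst hzz
    obtain ⟨e, he, hu, hv⟩ := st_step0 C h h0
    exact ⟨0, e, he, by ring, by simp [stF_zero, hu], by simp [stG_zero, hv]⟩


lemma st_pow_prime_eq {b n p : ℕ} (hp : p.Prime) (h : b ^ n = p) : b = p ∧ n = 1 := by
  have hn : n = 1 := by
    by_contra hn
    exact (Nat.Prime.not_prime_pow' hn) (h ▸ hp)
  subst hn
  exact ⟨by simpa using h, rfl⟩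

lemma st_final {a b c x1 y1 z1 x2 : ℕ} (hx1 : 0 < x1) (ha : 1 < a)
    (h1 : a ^ x1 + b ^ y1 = c ^ z1) (hs : stSpecial ((a:ℤ) ^ x1) ((b:ℤ) ^ y1))
    (h2 : (a:ℤ) ^ x2 = (a:ℤ) ^ x1 * ((a:ℤ) ^ x1 - 3 * (b:ℤ) ^ y1) ^ 2) :
    a = 3 ∧ b = 10 ∧ c = 13 ∧ z1 = 1 := by
  obtain ⟨d3, d9, hY, k, hk, e⟩ := hs
  have h3 : a ^ x2 = a ^ x1 * 3 ^ (2 * k) := by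
    rw [e] at h2
    have : (a:ℤ) ^ x2 = (a:ℤ) ^ x1 * 3 ^ (2 * k) := by rw [h2, mul_comm 2, pow_mul]; ring
    exact_mod_cast this
  have hlt : x1 < x2 := by
    by_contra hh
    have : a ^ x2 ≤ a ^ x1 := Nat.pow_le_pow_right (by omega) (by omega)
    have h4 : 1 < 3 ^ (2 * k) := Nat.one_lt_pow (by omega) (by norm_num)
    have h5 : 0 < a ^ x1 := by positivity
    nlinarith
  have h4 : a ^ (x2 - x1) = 3 ^ (2 * k) := by
    have : a ^ x1 * a ^ (x2 - x1) = a ^ x1 * 3 ^ (2 * k) := by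
      rw [← pow_add, ← h3]; congr 1; omega
    exact Nat.eq_of_mul_eq_mul_left (by positivity) this
  have h5 : a ∣ 3 ^ (2 * k) := by rw [← h4]; exact dvd_pow_self a (by omega)
  obtain ⟨i, -, hi⟩ := (Nat.dvd_prime_pow Nat.prime_three).1 h5
  have h6 : i * x1 < 2 := by
    by_contra hh
    apply d9
    rw [hi]; push_cast; rw [← pow_mul]
    have : (9:ℤ) = 3 ^ 2 := by norm_num
    rw [this]; exact pow_dvd_pow _ (by omega)
  have hi0 : i ≠ 0 := by rintro rfl; simp at hi; omega
  have hi1 : i = 1 := by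
    have : 0 < i := by omega
    nlinarith
  have hx : x1 = 1 := by
    subst hi1; omega
  subst hi1 hx
  simp only [pow_one] at hi
  subst hi
  have hb : b ^ y1 = 10 := by
    have : (b:ℤ) ^ y1 = 10 := by rw [hY]; norm_num
    exact_mod_cast this
  have hc : c ^ z1 = 13 := by rw [← h1, hb]; norm_num
  obtain ⟨hc1, hz1⟩ := st_pow_prime_eq (by norm_num) hc
  have hy : y1 = 1 := by
    by_contra hy
    by_cases hy0 : y1 = 0
    · subst hy0; simp at hb
    have hd : b ^ 2 ∣ 10 := hb ▸ pow_dvd_pow b (by omega)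
    have hle : b ≤ 3 := by have := Nat.le_of_dvd (by norm_num) hd; nlinarith
    interval_cases b <;> simp_all
  subst hy
  exact ⟨rfl, by simpa using hb, hc1, hz1⟩

lemma st_half (a x : ℕ) : (a:ℤ) ^ (x % 2) * ((a:ℤ) ^ (x / 2)) ^ 2 = (a:ℤ) ^ x := by
  rw [← pow_mul, ← pow_add]; congr 1; omega

lemma st_rad_half {a x : ℕ} (hx : 0 < x) : stRad a ((a:ℤ) ^ (x % 2) * (a:ℤ) ^ (x / 2)) := by
  intro l hl hd
  rw [← pow_add]
  exact hd.trans (dvd_pow_self _ (by omega))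

lemma st_coprime_of_sol {a b c x y z : ℕ} (hab : Nat.Coprime a b) (hx : 0 < x) (hy : 0 < y)
    (h : a ^ x + b ^ y = c ^ z) (hz : 0 < z) : Nat.Coprime a c ∧ Nat.Coprime b c := by
  constructor
  · apply Nat.Coprime.coprime_dvd_left (dvd_pow_self a hx.ne')
    apply Nat.Coprime.coprime_dvd_right (dvd_pow_self c hz.ne')
    rw [← h]; simp; exact Nat.Coprime.pow x y hab
  · apply Nat.Coprime.coprime_dvd_left (dvd_pow_self b hy.ne')
    apply Nat.Coprime.coprime_dvd_right (dvd_pow_self c hz.ne')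
    rw [← h]; simp; exact Nat.Coprime.pow y x hab.symm

set_option maxHeartbeats 1000000 in
lemma st_core {a b c : ℕ} (ha : 1 < a) (hb : 1 < b) (hc : 1 < c) (hodd : Odd c)
    (hab : Nat.Coprime a b) {x1 y1 z1 x2 y2 z2 : ℕ} (hx1 : 0 < x1) (hy1 : 0 < y1) (hz1 : 0 < z1)
    (hx2 : 0 < x2) (hy2 : 0 < y2) (hz2 : 0 < z2) (e1 : a ^ x1 + b ^ y1 = c ^ z1)
    (e2 : a ^ x2 + b ^ y2 = c ^ z2) (px : x1 % 2 = x2 % 2) (py : y1 % 2 = y2 % 2)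
    (s : ℤ) (hs : s = 1 ∨ s = -1)
    (hcomp : ∀ p : ℕ, p.Prime → p ∣ c → 
      (p:ℤ) ∣ (a:ℤ) ^ (x1/2) * (b:ℤ) ^ (y2/2) - s * ((a:ℤ) ^ (x2/2) * (b:ℤ) ^ (y1/2))) :
    (z1 = z2 → x1 = x2 ∧ y1 = y2) ∧ (z1 < z2 → 
      ((a = 3 ∧ b = 10) ∨ (a = 10 ∧ b = 3)) ∧ c = 13 ∧ z1 = 1 ∧ z2 = 3) := by
  obtain ⟨cac, cbc⟩ := st_coprime_of_sol hab hx1 hy1 e1 hz1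
  have ca : IsCoprime (a:ℤ) (c:ℤ) := Nat.isCoprime_iff_coprime.2 cac
  have cb : IsCoprime (b:ℤ) (c:ℤ) := Nat.isCoprime_iff_coprime.2 cbc
  have c2 : IsCoprime (2:ℤ) (c:ℤ) := by
    have := Nat.isCoprime_iff_coprime.2 (Nat.coprime_two_left.2 hodd)
    exact_mod_cast this
  set A : ℤ := (a:ℤ) ^ (x1 % 2) with hAdef
  set B : ℤ := (b:ℤ) ^ (y1 % 2) with hBdef
  set u1 : ℤ := (a:ℤ) ^ (x1 / 2) with hu1
  set u2 : ℤ := (a:ℤ) ^ (x2 / 2) with hu2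
  set v1 : ℤ := (b:ℤ) ^ (y1 / 2) with hv1
  set w2 : ℤ := (b:ℤ) ^ (y2 / 2) with hw2
  set v2 : ℤ := s * w2 with hv2
  have ss : s * s = 1 := by rcases hs with rfl | rfl <;> norm_num
  have A1 : A * u1 ^ 2 = (a:ℤ) ^ x1 := st_half a x1
  have A2 : A * u2 ^ 2 = (a:ℤ) ^ x2 := by rw [hAdef, px]; exact st_half a x2
  have B1 : B * v1 ^ 2 = (b:ℤ) ^ y1 := st_half b y1
  have B2 : B * v2 ^ 2 = (b:ℤ) ^ y2 := by
    rw [hv2, mul_pow, sq s, ss, one_mul, hBdef, py]; exact st_half b y2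
  have n1 : A * u1 ^ 2 + B * v1 ^ 2 = (c:ℤ) ^ z1 := by rw [A1, B1]; exact_mod_cast e1
  have n2 : A * u2 ^ 2 + B * v2 ^ 2 = (c:ℤ) ^ z2 := by rw [A2, B2]; exact_mod_cast e2
  have cA : IsCoprime A c := ca.pow_left
  have cB : IsCoprime B c := cb.pow_left
  have cu1 : IsCoprime u1 c := ca.pow_left
  have cu2 : IsCoprime u2 c := ca.pow_left
  have cv1 : IsCoprime v1 c := cb.pow_left
  have cs : IsCoprime s (c:ℤ) := ⟨s, 0, by linarith⟩
  have cv2 : IsCoprime v2 c := cs.mul_left cb.pow_left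
  have hcomp' : ∀ p : ℕ, p.Prime → p ∣ c → (p:ℤ) ∣ u1 * v2 - u2 * v1 := by
    intro p hp hpc
    have := (hcomp p hp hpc).mul_left s
    have e : u1 * v2 - u2 * v1 = s * (u1 * w2 - s * (u2 * v1)) := by
      rw [hv2]; linear_combination u2 * v1 * ss
    rw [e]; exact this
  have cop : IsCoprime (A * (u1 * v2 + u2 * v1)) (c:ℤ) := by
    refine cA.mul_left ?_
    rw [Int.isCoprime_iff_gcd_eq_one]
    refine Nat.eq_one_iff_not_exists_prime_dvd.2 ?_
    intro l hl hd
    have hd' : (l:ℤ) ∣ Int.gcd (u1 * v2 + u2 * v1) c := by exact_mod_cast hd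
    have hl1 := hd'.trans (Int.gcd_dvd_left ..)
    have hl2 := hd'.trans (Int.gcd_dvd_right ..)
    have hl3 := hcomp' l hl (by exact_mod_cast hl2)
    have hl4 : (l:ℤ) ∣ 2 * (u1 * v2) := by
      have h5 := dvd_add hl1 hl3
      have e : 2 * (u1 * v2) = (u1 * v2 + u2 * v1) + (u1 * v2 - u2 * v1) := by ring
      rw [e]; exact h5
    exact st_coprime_prime (c2.mul_left (cu1.mul_left cv2)) hl hl4 hl2
  have dz : ∀ z : ℕ, 0 < z → (c:ℤ) ∣ (c:ℤ) ^ z := fun z hz => dvd_pow_self _ hz.ne'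
  have hcc : (c:ℤ) ∣ u1 * v2 - u2 * v1 := by
    have : (c:ℤ) ∣ (A * (u1 * v2 + u2 * v1)) * (u1 * v2 - u2 * v1) := by
      rw [show (A * (u1 * v2 + u2 * v1)) * (u1 * v2 - u2 * v1) = (c:ℤ)^z1 * v2^2 - (c:ℤ)^z2 * v1 ^ 2 by
        rw [← n1, ← n2]; ring]
      exact dvd_sub ((dz _ hz1).mul_right _) ((dz _ hz2).mul_right _)
    exact cop.symm.dvd_of_dvd_mul_left this
  obtain ⟨k, l, hkl⟩ := cu1
  have ck : IsCoprime k (c:ℤ) := ⟨u1, l, by linarith⟩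
  set t : ℤ := v1 * k with ht
  have t1 : (c:ℤ) ∣ v1 - t * u1 := ⟨v1 * l, by rw [ht]; linear_combination -v1 * hkl⟩
  have t2 : (c:ℤ) ∣ v2 - t * u2 := by
    obtain ⟨n, hn⟩ := hcc
    exact ⟨v2 * l + k * n, by rw [ht]; linear_combination -v2 * hkl + k * hn⟩
  have C : stCtx A B c t a b := {
    hA := by positivity
    hB := by positivity
    hc := by exact_mod_cast hc
    c2 := c2, cA := cA, cB := cB, ca := ca, cb := cb
    ct := cv1.mul_left ck
    ht := by
      have : (c:ℤ) ∣ u1 ^ 2 * (A + B * t ^ 2) := by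
        obtain ⟨n, hn⟩ := t1
        obtain ⟨m, hm⟩ := dz z1 hz1
        refine ⟨m - B * n * (v1 + t * u1), ?_⟩
        linear_combination n1 + hm - B * (v1 + t * u1) * hn
      have cu1' : IsCoprime u1 (c:ℤ) := ⟨k, l, hkl⟩
      exact (cu1'.pow_left (m := 2)).symm.dvd_of_dvd_mul_left this
    ha := by exact_mod_cast ha
    hb := by exact_mod_cast hb }
  have g1 : stGood A B c t a b u1 v1 z1 := ⟨n1, t1, ⟨k, l, hkl⟩, st_rad_half hx1, st_rad_half hy1⟩
  have g2 : stGood A B c t a b u2 v2 z2 := by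
    refine ⟨n2, t2, cu2, ?_, ?_⟩
    · rw [hAdef, px]; exact st_rad_half hx2
    · rw [hBdef, py, hv2]
      intro l hl hd
      have h5 := (st_rad_half hy2 l hl hd).mul_left s
      have e : (b:ℤ) ^ (y2 % 2) * (s * w2) = s * ((b:ℤ) ^ (y2 % 2) * (b:ℤ) ^ (y2 / 2)) := by
        rw [hw2]; ring
      rw [e]; exact h5
  classical
  have hex : ∃ z, 1 ≤ z ∧ ∃ u v, stGood A B c t a b u v z := ⟨z1, hz1, u1, v1, g1⟩
  obtain ⟨hz0, u0, v0, g0⟩ := Nat.find_spec hex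
  set z0 := Nat.find hex with hz0def
  have hmin : ∀ z u v, 1 ≤ z → stGood A B c t a b u v z → z0 ≤ z := 
    fun z u v hz hg => Nat.find_min' hex ⟨hz, u, v, hg⟩
  obtain ⟨m1, f1, hf1, r1, p1, q1⟩ := st_all C hz0 g0 hmin z1 u1 v1 hz1 g1
  obtain ⟨m2, f2, hf2, r2, p2, q2⟩ := st_all C hz0 g0 hmin z2 u2 v2 hz2 g2
  set X : ℤ := A * u0 ^ 2 with hXdef
  set Y : ℤ := B * v0 ^ 2 with hYdef
  have sf1 : f1 ^ 2 = 1 := by rcases hf1 with h | h <;> rw [h] <;> norm_num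
  have sf2 : f2 ^ 2 = 1 := by rcases hf2 with h | h <;> rw [h] <;> norm_num
  have X1 : (a:ℤ) ^ x1 = X * stF X Y m1 ^ 2 := by
    rw [← A1, p1, hXdef]; linear_combination A * u0 ^ 2 * stF X Y m1 ^ 2 * sf1
  have X2 : (a:ℤ) ^ x2 = X * stF X Y m2 ^ 2 := by
    rw [← A2, p2, hXdef]; linear_combination A * u0 ^ 2 * stF X Y m2 ^ 2 * sf2
  have Y1 : (b:ℤ) ^ y1 = Y * stG X Y m1 ^ 2 := by
    rw [← B1, q1, hYdef]; linear_combination B * v0 ^ 2 * stG X Y m1 ^ 2 * sf1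
  have Y2 : (b:ℤ) ^ y2 = Y * stG X Y m2 ^ 2 := by
    rw [← B2, q2, hYdef]; linear_combination B * v0 ^ 2 * stG X Y m2 ^ 2 * sf2
  have hc1 : (1:ℤ) < c := by exact_mod_cast hc
  constructor
  · intro hzz
    have hm : m1 = m2 := by
      have : (2 * m1 + 1) * z0 = (2 * m2 + 1) * z0 := by rw [← r1, ← r2, hzz]
      have := Nat.eq_of_mul_eq_mul_right hz0 this
      omega
    subst hm
    rw [← X2] at X1
    rw [← Y2] at Y1
    exact ⟨Nat.pow_right_injective ha (by exact_mod_cast X1), Nat.pow_right_injective hb (by exact_mod_cast Y1)⟩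
  · intro hlt
    have hm : m1 < m2 := by
      rw [r1, r2] at hlt
      have := Nat.lt_of_mul_lt_mul_right hlt
      omega
    have aX : ∀ l : ℕ, l.Prime → (l:ℤ) ∣ a → (l:ℤ) ∣ X := by
      intro l hl hd
      have := g0.ra l hl hd
      rw [hXdef, sq, ← mul_assoc]; exact this.mul_right _
    have bY : ∀ l : ℕ, l.Prime → (l:ℤ) ∣ b → (l:ℤ) ∣ Y := by
      intro l hl hd
      have := g0.rb l hl hd
      rw [hYdef, sq, ← mul_assoc]; exact this.mul_right _
    have hX0 : 0 < X := by
      by_contra hh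
      have h1 : 0 < (a:ℤ) ^ x1 := by positivity
      rw [X1] at h1
      exact absurd h1 (not_lt.2 (mul_nonpos_of_nonpos_of_nonneg (not_lt.1 hh) (sq_nonneg _)))
    have hY0 : 0 < Y := by
      by_contra hh
      have h1 : 0 < (b:ℤ) ^ y1 := by positivity
      rw [Y1] at h1
      exact absurd h1 (not_lt.2 (mul_nonpos_of_nonpos_of_nonneg (not_lt.1 hh) (sq_nonneg _)))
    have hX2 : 2 ≤ X := by
      obtain ⟨l, hl, hla⟩ := Nat.exists_prime_and_dvd (n := a) (by omega)
      have := Int.le_of_dvd hX0 (aX l hl (by exact_mod_cast hla))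
      have := hl.two_le
      omega
    have hY2 : 2 ≤ Y := by
      obtain ⟨l, hl, hla⟩ := Nat.exists_prime_and_dvd (n := b) (by omega)
      have := Int.le_of_dvd hY0 (bY l hl (by exact_mod_cast hla))
      have := hl.two_le
      omega
    have cX : IsCoprime X c := cA.mul_left g0.cop.pow_left
    have hco : IsCoprime X Y := by
      have h1 : IsCoprime X ((c:ℤ) ^ z0) := cX.pow_right
      rw [← g0.norm] at h1
      have := IsCoprime.add_mul_left_right h1 (-1)
      have e : Y = A * u0 ^ 2 + B * v0 ^ 2 + X * -1 := by rw [hXdef, hYdef]; ring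
      rw [e]; exact this
    have hF : stRad (stF X Y m2) X := by
      intro l hl hd
      apply aX l hl
      have : (l:ℤ) ∣ (a:ℤ) ^ x2 := by rw [X2, sq]; exact (hd.mul_right _).mul_left _
      exact (Nat.prime_iff_prime_int.1 hl).dvd_of_dvd_pow this
    have hG : stRad (stG X Y m2) Y := by
      intro l hl hd
      apply bY l hl
      have : (l:ℤ) ∣ (b:ℤ) ^ y2 := by rw [Y2, sq]; exact (hd.mul_right _).mul_left _
      exact (Nat.prime_iff_prime_int.1 hl).dvd_of_dvd_pow this
    obtain ⟨hm2, hsp⟩ := st_E hX2 hY2 hco m2 (by omega) hF hG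
    have hm1 : m1 = 0 := by omega
    subst hm2 hm1
    rw [stF_zero, one_pow, mul_one] at X1
    rw [stG_zero, one_pow, mul_one] at Y1
    rw [stF_one] at X2
    rw [stG_one] at Y2
    rw [← X1, ← Y1] at hsp X2 Y2
    have hz12 : z2 = 3 * z1 := by rw [r1, r2]; ring
    rcases hsp with hsp | hsp
    · obtain ⟨h1, h2, h3, h4⟩ := st_final hx1 ha e1 hsp X2
      exact ⟨Or.inl ⟨h1, h2⟩, h3, h4, by omega⟩
    · obtain ⟨h1, h2, h3, h4⟩ := st_final hy1 hb (by rw [add_comm]; exact e1) hsp (by rw [Y2]; ring)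
      exact ⟨Or.inr ⟨h2, h1⟩, h3, h4, by omega⟩


lemma st_pow_mod {a m n : ℕ} (h : a ^ n % m = 1 % m) (x : ℕ) : a ^ x % m = a ^ (x % n) % m := by
  conv_lhs => rw [← Nat.div_add_mod x n]
  have : a ^ n ≡ 1 [MOD m] := h
  have := (this.pow (x / n)).mul_right (a ^ (x % n))
  rw [pow_add, pow_mul]
  simpa [Nat.ModEq] using this

lemma st_exc {x y z : ℕ} (hy : 0 < y) (hz : 0 < z) (h : 3 ^ x + 10 ^ y = 13 ^ z) :
    x % 2 = 1 ∧ y % 2 = 1 := by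
  have key : ∀ m n : ℕ, 3 ^ n % m = 1 % m → 10 ^ n % m = 1 % m → 13 ^ n % m = 1 % m → 
      (3 ^ (x % n) + 10 ^ (y % n)) % m = 13 ^ (z % n) % m := by
    intro m n h1 h2 h3
    rw [← st_pow_mod h3, ← h, Nat.add_mod, ← st_pow_mod h1, ← st_pow_mod h2, ← Nat.add_mod]
  have hy1 : y % 2 = 1 := by
    have h13 : (3 ^ (x % 6) + 10 ^ (y % 6)) % 13 = 0 := by
      rw [Nat.add_mod, ← st_pow_mod (by norm_num), ← st_pow_mod (by norm_num), ← Nat.add_mod, h]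
      obtain ⟨w, rfl⟩ : ∃ w, z = w + 1 := ⟨z - 1, by omega⟩
      rw [pow_succ]; omega
    have hx6 : x % 6 < 6 := Nat.mod_lt _ (by norm_num)
    have hy6 : y % 6 < 6 := Nat.mod_lt _ (by norm_num)
    rw [show y % 2 = (y % 6) % 2 by omega]
    generalize x % 6 = X at *
    generalize y % 6 = Y at *
    clear key
    interval_cases X <;> interval_cases Y <;> simp_all
  refine ⟨?_, hy1⟩
  by_contra hx
  have hx0 : x % 2 = 0 := by omega
  have h4 : (3 ^ (x % 2) + 10 ^ y) % 4 = 1 := by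
    rw [Nat.add_mod, ← st_pow_mod (by norm_num), ← Nat.add_mod, h, Nat.pow_mod]; norm_num
  have hyy : 3 ≤ y := by
    by_contra hh
    have : y = 1 := by omega
    subst this
    rw [hx0] at h4; simp at h4
  have hz2 : z % 2 = 0 := by
    have h8 : 10 ^ y % 8 = 0 := by
      obtain ⟨w, rfl⟩ : ∃ w, y = w + 3 := ⟨y - 3, by omega⟩
      rw [pow_add]; omega
    have : 13 ^ (z % 2) % 8 = 1 := by
      rw [← st_pow_mod (by norm_num), ← h, Nat.add_mod, h8, st_pow_mod (n := 2) (by norm_num), hx0]; norm_num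
    have hz6 : z % 2 < 2 := Nat.mod_lt _ (by norm_num)
    generalize z % 2 = Z at *
    interval_cases Z <;> simp_all
  have k7 := key 7 36 (by norm_num) (by norm_num) (by norm_num)
  have k19 := key 19 36 (by norm_num) (by norm_num) (by norm_num)
  have k37 := key 37 36 (by norm_num) (by norm_num) (by norm_num)
  have D : ∀ X : Fin 18, ∀ Y : Fin 18, (3 ^ (2*X.1) + 10 ^ (2*Y.1+1)) % 7 = 1 → ∀ Z : Fin 18,
    (3 ^ (2*X.1) + 10 ^ (2*Y.1+1)) % 19 = 13 ^ (2*Z.1) % 19 →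
      (3 ^ (2*X.1) + 10 ^ (2*Y.1+1)) % 37 = 13 ^ (2*Z.1) % 37 → False := by
    decide +kernel
  have e1 : x % 36 = 2 * (x % 36 / 2) := by omega
  have e2 : y % 36 = 2 * (y % 36 / 2) + 1 := by omega
  have e3 : z % 36 = 2 * (z % 36 / 2) := by omega
  rw [e1, e2, e3] at k7 k19 k37
  refine D ⟨x % 36 / 2, by omega⟩ ⟨y % 36 / 2, by omega⟩ ?_ ⟨z % 36 / 2, by omega⟩ k19 k37
  simp only
  rw [k7, pow_mul, Nat.pow_mod]; norm_num

lemma st_par {p a b : ℕ} (hp : p.Prime) (hp2 : p ≠ 2) (ha : ¬ p ∣ a) (hb : ¬ p ∣ b) :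
    ∃ i j : ℤ, (Odd i ∨ Odd j) ∧ ∀ x1 y1 x2 y2 : ℕ, p ∣ a ^ x1 + b ^ y1 → p ∣ a ^ x2 + b ^ y2 →
      Even ((i * x1 - j * y1) - (i * x2 - j * y2)) := by
  have := Fact.mk hp
  have ha' : (a : ZMod p) ≠ 0 := by rwa [Ne, ZMod.natCast_eq_zero_iff]
  have hb' : (b : ZMod p) ≠ 0 := by rwa [Ne, ZMod.natCast_eq_zero_iff]
  obtain ⟨g, hg⟩ := IsCyclic.exists_zpow_surjective (G := (ZMod p)ˣ)
  obtain ⟨i, hi⟩ := hg (Units.mk0 _ ha')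
  obtain ⟨j, hj⟩ := hg (Units.mk0 _ hb')
  obtain ⟨h, hh⟩ := hg (-1)
  have h2 : (-1 : (ZMod p)ˣ) ≠ 1 := by
    have : Fact (2 < p) := ⟨by have := hp.two_le; omega⟩
    intro hc
    have : ((-1 : (ZMod p)ˣ) : ZMod p) = 1 := by rw [hc]; rfl
    exact ZMod.neg_one_ne_one (by simpa using this)
  -- order of `g` is even, and `h` is an odd multiple of its half
  have hsol : ∀ x y : ℕ, p ∣ a ^ x + b ^ y → (g ^ (i * x - j * y - h) : (ZMod p)ˣ) = 1 := by
    intro x y hd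
    have e : (a:ZMod p) ^ x + (b:ZMod p) ^ y = 0 := by
      have := (ZMod.natCast_eq_zero_iff _ _).2 hd
      exact_mod_cast this
    have e2 : (Units.mk0 _ ha') ^ x = (-1) * (Units.mk0 _ hb') ^ y := by
      ext; push_cast; simp; linear_combination e
    simp only at hi hj hh
    rw [zpow_sub, zpow_sub, zpow_mul, zpow_mul, hi, hj, hh, zpow_natCast, zpow_natCast, e2]
    group
  have h1 : (g ^ (2 * h) : (ZMod p)ˣ) = 1 := by
    rw [mul_comm, zpow_mul, show g ^ h = -1 from hh]; simp
  have hnh : ¬ (g ^ h : (ZMod p)ˣ) = 1 := by rw [show g ^ h = -1 from hh]; exact h2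
  have hpar : ∀ x y : ℕ, p ∣ a ^ x + b ^ y → ∃ o : ℤ, Odd o ∧ 2 * (i * x - j * y) = o * orderOf g := by
    intro x y hd
    have := orderOf_dvd_iff_zpow_eq_one.2 (hsol x y hd)
    obtain ⟨m, hm⟩ := this
    obtain ⟨n, hn⟩ := orderOf_dvd_iff_zpow_eq_one.2 h1
    have no : Odd n := by
      rw [← Int.not_even_iff_odd]
      rintro ⟨r, hr⟩
      apply hnh
      apply orderOf_dvd_iff_zpow_eq_one.1
      exact ⟨r, by rw [hr] at hn; linarith⟩
    exact ⟨2 * m + n, by rw [add_comm]; exact no.add_even (even_two_mul m), by linear_combination 2 * hm + hn⟩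
  by_cases hij : i = 0 ∧ j = 0
  · refine ⟨1, 1, Or.inl odd_one, ?_⟩
    intro x1 y1 x2 y2 hd1 _
    obtain ⟨o, ho, e⟩ := hpar x1 y1 hd1
    rw [hij.1, hij.2] at e
    have h0 : (orderOf g : ℤ) ≠ 0 := by exact_mod_cast (orderOf_pos g).ne'
    have e' : o * (orderOf g : ℤ) = 0 := by rw [← e]; ring
    rcases mul_eq_zero.1 e' with e | e
    · subst e; simp at ho
    · exact absurd e h0
  · have hd : 0 < Int.gcd i j := by
      rw [Int.gcd_pos_iff]; tauto
    obtain ⟨i', j', hcop, ei, ej⟩ := Int.exists_gcd_one hd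
    set d := Int.gcd i j
    refine ⟨i', j', ?_, ?_⟩
    · by_contra hcon
      push Not at hcon
      simp only [Int.not_odd_iff_even] at hcon
      have : (2:ℤ) ∣ Int.gcd i' j' := Int.dvd_coe_gcd hcon.1.two_dvd hcon.2.two_dvd
      rw [hcop] at this; norm_num at this
    · intro x1 y1 x2 y2 hd1 hd2
      obtain ⟨o1, ho1, e1⟩ := hpar x1 y1 hd1
      obtain ⟨o2, ho2, e2⟩ := hpar x2 y2 hd2
      have : (2 * d : ℤ) * ((i' * x1 - j' * y1) * o2) = (2 * d) * ((i' * x2 - j' * y2) * o1) := by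
        rw [ei, ej] at e1 e2
        linear_combination o2 * e1 - o1 * e2
      have := mul_left_cancel₀ (by positivity) this
      have h3 : Even ((i' * x1 - j' * y1) * o2) ↔ Even ((i' * x2 - j' * y2) * o1) := by rw [this]
      rw [Int.even_mul, Int.even_mul] at h3
      rw [← Int.not_even_iff_odd] at ho1 ho2
      rw [Int.even_sub]; tauto


def stS (a b c : ℕ) : Set (ℕ × ℕ × ℕ) := {p : ℕ × ℕ × ℕ | 0 < p.1 ∧ 0 < p.2.1 ∧ 0 < p.2.2 ∧
      a ^ p.1 + b ^ p.2.1 = c ^ p.2.2}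

lemma st_prop1 {A B C D : Prop} (h : (A ↔ B) ↔ (C ↔ D)) (h2 : B ↔ D) : A ↔ C := by tauto

lemma st_prop2 {A B C D : Prop} (h : (A ↔ B) ↔ (C ↔ D)) (h2 : ¬ (B ↔ D)) : ¬ (A ↔ C) := by tauto

lemma st_classes {a b c : ℕ} (hc : 1 < c) (hodd : Odd c) (hab : Nat.Coprime a b) :
    ∃ P Q : ℕ × ℕ, ∀ t ∈ stS a b c, (t.1 % 2, t.2.1 % 2) = P ∨ (t.1 % 2, t.2.1 % 2) = Q := by
  by_cases he : ∃ t, t ∈ stS a b c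
  swap
  · push Not at he
    exact ⟨(0, 0), (0, 0), fun t ht => absurd ht (he t)⟩
  obtain ⟨⟨x0, y0, z0⟩, h0⟩ := he
  obtain ⟨hx0, hy0, hz0, e0⟩ := id h0
  simp only at hx0 hy0 hz0 e0
  obtain ⟨ca, cb⟩ := st_coprime_of_sol hab hx0 hy0 e0 hz0
  obtain ⟨p, hp, hpc⟩ := Nat.exists_prime_and_dvd (n := c) (by omega)
  have hp2 : p ≠ 2 := by
    rintro rfl
    exact (Nat.not_even_iff_odd.2 hodd) (even_iff_two_dvd.2 hpc)
  have hpa : ¬ p ∣ a := fun h => hp.one_lt.ne' (Nat.dvd_one.1 (ca ▸ Nat.dvd_gcd h hpc))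
  have hpb : ¬ p ∣ b := fun h => hp.one_lt.ne' (Nat.dvd_one.1 (cb ▸ Nat.dvd_gcd h hpc))
  obtain ⟨i, j, hij, H⟩ := st_par hp hp2 hpa hpb
  have hd : ∀ t ∈ stS a b c, p ∣ a ^ t.1 + b ^ t.2.1 := by
    rintro t ⟨_, _, h3, h4⟩
    rw [h4]; exact hpc.trans (dvd_pow_self _ h3.ne')
  have H' : ∀ t ∈ stS a b c, Even ((i * t.1 - j * t.2.1) - (i * x0 - j * y0)) := fun t ht =>
    H _ _ _ _ (hd t ht) (hd _ h0)
  simp only [Int.even_sub, Int.even_mul, Int.even_coe_nat, ← Int.not_even_iff_odd, Nat.even_iff] at H' hij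
  by_cases h1 : Even i <;> by_cases h2 : Even j
  · tauto
  · refine ⟨(0, y0 % 2), (1, y0 % 2), fun t ht => ?_⟩
    have := H' t ht
    simp only [Prod.mk.injEq]
    simp only [h1, h2, true_or, false_or, true_iff, iff_true, iff_self] at this
    omega
  · refine ⟨(x0 % 2, 0), (x0 % 2, 1), fun t ht => ?_⟩
    have := H' t ht
    simp only [Prod.mk.injEq]
    simp only [h1, h2, true_or, false_or, true_iff, iff_true, iff_self] at this
    omega
  · refine ⟨(x0 % 2, y0 % 2), ((x0 + 1) % 2, (y0 + 1) % 2), fun t ht => ?_⟩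
    have := H' t ht
    simp only [Prod.mk.injEq]
    simp only [h1, h2, false_or] at this
    omega

lemma st_sign {p : ℕ} {A B u v u0 v0 : ℤ} (hp : p.Prime) (hA : ¬ (p:ℤ) ∣ A) (h1 : (p:ℤ) ∣ A * u ^ 2 + B * v ^ 2)
    (h2 : (p:ℤ) ∣ A * u0 ^ 2 + B * v0 ^ 2) : (p:ℤ) ∣ u * v0 - u0 * v ∨ (p:ℤ) ∣ u * v0 + u0 * v := by
  have hp' := Nat.prime_iff_prime_int.1 hp
  have h3 : (p:ℤ) ∣ A * ((u * v0 - u0 * v) * (u * v0 + u0 * v)) := by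
    have : A * ((u * v0 - u0 * v) * (u * v0 + u0 * v)) = v0 ^ 2 * (A * u ^ 2 + B * v ^ 2) - v ^ 2 * (A * u0 ^ 2 + B * v0 ^ 2) := by
      ring
    rw [this]
    exact dvd_sub (h1.mul_left _) (h2.mul_left _)
  exact hp'.dvd_or_dvd ((hp'.dvd_or_dvd h3).resolve_left hA)

/-- Two solutions in the same parity class with the same sign pattern. -/
lemma st_pair {a b c : ℕ} (ha : 1 < a) (hb : 1 < b) (hc : 1 < c) (hodd : Odd c)
    (hab : Nat.Coprime a b) {t1 t2 : ℕ × ℕ × ℕ} (h1 : t1 ∈ stS a b c) (h2 : t2 ∈ stS a b c)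
    (px : t1.1 % 2 = t2.1 % 2) (py : t1.2.1 % 2 = t2.2.1 % 2)
    (s : ℤ) (hs : s = 1 ∨ s = -1)
    (hcomp : ∀ p : ℕ, p.Prime → p ∣ c → 
      (p:ℤ) ∣ (a:ℤ) ^ (t1.1/2) * (b:ℤ) ^ (t2.2.1/2) - s * ((a:ℤ) ^ (t2.1/2) * (b:ℤ) ^ (t1.2.1/2))) :
    t1 = t2 ∨ (((a = 3 ∧ b = 10) ∨ (a = 10 ∧ b = 3)) ∧ c = 13 ∧ 
      ((t1.2.2 = 1 ∧ t2.2.2 = 3) ∨ (t1.2.2 = 3 ∧ t2.2.2 = 1))) := by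
  obtain ⟨x1, y1, z1⟩ := t1
  obtain ⟨x2, y2, z2⟩ := t2
  obtain ⟨hx1, hy1, hz1, e1⟩ := h1
  obtain ⟨hx2, hy2, hz2, e2⟩ := h2
  simp only at *
  have ss : s * s = 1 := by rcases hs with rfl | rfl <;> norm_num
  have hcomp2 : ∀ p : ℕ, p.Prime → p ∣ c → 
      (p:ℤ) ∣ (a:ℤ) ^ (x2/2) * (b:ℤ) ^ (y1/2) - s * ((a:ℤ) ^ (x1/2) * (b:ℤ) ^ (y2/2)) := by
    intro p hp hpc
    have h3 := (hcomp p hp hpc).mul_left (-s)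
    generalize (a:ℤ) ^ (x2/2) * (b:ℤ) ^ (y1/2) = U at *
    generalize (a:ℤ) ^ (x1/2) * (b:ℤ) ^ (y2/2) = V at *
    have e : U - s * V = -s * (V - s * U) := by linear_combination -U * ss
    rw [e]; exact h3
  have c1 := st_core ha hb hc hodd hab hx1 hy1 hz1 hx2 hy2 hz2 e1 e2 px py s hs hcomp
  have c2 := st_core ha hb hc hodd hab hx2 hy2 hz2 hx1 hy1 hz1 e2 e1 px.symm py.symm s hs hcomp2
  rcases lt_trichotomy z1 z2 with h | h | h
  · obtain ⟨h1, h2, h3, h4⟩ := c1.2 h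
    exact Or.inr ⟨h1, h2, Or.inl ⟨h3, h4⟩⟩
  · have := c1.1 h
    left; rw [h, this.1, this.2]
  · obtain ⟨h1, h2, h3, h4⟩ := c2.2 h
    exact Or.inr ⟨h1, h2, Or.inr ⟨h4, h3⟩⟩

lemma st_sol_dvd {a b c p : ℕ} {t : ℕ × ℕ × ℕ} (ht : t ∈ stS a b c) (hpc : p ∣ c) :
    (p:ℤ) ∣ (a:ℤ) ^ (t.1 % 2) * ((a:ℤ) ^ (t.1 / 2)) ^ 2 + (b:ℤ) ^ (t.2.1 % 2) * ((b:ℤ) ^ (t.2.1 / 2)) ^ 2 := by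
  rw [st_half, st_half]
  obtain ⟨_, _, h3, h4⟩ := ht
  have : p ∣ a ^ t.1 + b ^ t.2.1 := by rw [h4]; exact hpc.trans (dvd_pow_self _ h3.ne')
  exact_mod_cast this

lemma st_cancel {p : ℕ} (hp : p.Prime) {k X : ℤ} (hk : ¬ (p:ℤ) ∣ k) (h : (p:ℤ) ∣ k * X) : (p:ℤ) ∣ X :=
  ((Nat.prime_iff_prime_int.1 hp).dvd_or_dvd h).resolve_left hk

lemma st_comb {p u0 v0 u1 v1 u2 v2 s1 s2 : ℤ} (hs : s2 ^ 2 = 1) (h1 : p ∣ u1 * v0 - s1 * (u0 * v1))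
    (h2 : p ∣ u2 * v0 - s2 * (u0 * v2)) : p ∣ (u0 * v0) * (u1 * v2 - (s1 * s2) * (u2 * v1)) := by
  have e : (u0 * v0) * (u1 * v2 - (s1 * s2) * (u2 * v1)) = 
    u0 * v2 * (u1 * v0 - s1 * (u0 * v1)) - s1 * s2 * u0 * v1 * (u2 * v0 - s2 * (u0 * v2)) := by
    linear_combination -s1 * u0 ^ 2 * v1 * v2 * hs
  rw [e]
  exact dvd_sub (h1.mul_left _) (h2.mul_left _)

lemma st_class_bound {a b c : ℕ} (ha : 1 < a) (hb : 1 < b) (hc : 1 < c) (hodd : Odd c)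
    (hab : Nat.Coprime a b) (hne : ¬ (((a = 3 ∧ b = 10) ∨ (a = 10 ∧ b = 3)) ∧ c = 13)) (P : ℕ × ℕ) :
    {t | t ∈ stS a b c ∧ (t.1 % 2, t.2.1 % 2) = P}.ncard ≤ 2 ^ (c.primeFactors.card - 1) := by
  classical
  set T := {t | t ∈ stS a b c ∧ (t.1 % 2, t.2.1 % 2) = P} with hT
  rcases T.eq_empty_or_nonempty with he | ⟨t0, ht0⟩
  · rw [he]; simp
  obtain ⟨ca, cb⟩ := st_coprime_of_sol hab ht0.1.1 ht0.1.2.1 ht0.1.2.2.2 ht0.1.2.2.1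
  have hpa : ∀ p : ℕ, p.Prime → p ∣ c → ∀ n, ¬ (p:ℤ) ∣ (a:ℤ) ^ n := by
    intro p hp hpc n h
    have h := Nat.Prime.dvd_of_dvd_pow hp (by exact_mod_cast h : p ∣ a ^ n)
    exact hp.one_lt.ne' (Nat.dvd_one.1 (ca ▸ Nat.dvd_gcd h hpc))
  have hpb : ∀ p : ℕ, p.Prime → p ∣ c → ∀ n, ¬ (p:ℤ) ∣ (b:ℤ) ^ n := by
    intro p hp hpc n h
    have h := Nat.Prime.dvd_of_dvd_pow hp (by exact_mod_cast h : p ∣ b ^ n)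
    exact hp.one_lt.ne' (Nat.dvd_one.1 (cb ▸ Nat.dvd_gcd h hpc))
  set p0 := c.minFac with hp0
  have hp0m : p0 ∈ c.primeFactors := by
    rw [Nat.mem_primeFactors]; exact ⟨Nat.minFac_prime (by omega), Nat.minFac_dvd c, by omega⟩
  let pl : ℕ → ℕ × ℕ × ℕ → Prop := fun p t => 
    (p:ℤ) ∣ (a:ℤ) ^ (t.1 / 2) * (b:ℤ) ^ (t0.2.1 / 2) - (a:ℤ) ^ (t0.1 / 2) * (b:ℤ) ^ (t.2.1 / 2)
  have hmin : ∀ p : ℕ, p.Prime → p ∣ c → ∀ t ∈ T, ¬ pl p t → 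
    (p:ℤ) ∣ (a:ℤ) ^ (t.1 / 2) * (b:ℤ) ^ (t0.2.1 / 2) + (a:ℤ) ^ (t0.1 / 2) * (b:ℤ) ^ (t.2.1 / 2) := by
    intro p hp hpc t ht hn
    have q1 := st_sol_dvd ht.1 hpc
    have q2 := st_sol_dvd ht0.1 hpc
    have q3 := ht.2.trans ht0.2.symm
    simp only [Prod.mk.injEq] at q3
    rw [q3.1, q3.2] at q1
    exact (st_sign hp (hpa p hp hpc _) q1 q2).resolve_left hn
  let π : ℕ × ℕ × ℕ → Finset ℕ := fun t => (c.primeFactors.erase p0).filter (fun p => ¬ (pl p t ↔ pl p0 t))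
  have hmap : ∀ t ∈ T, π t ∈ ((c.primeFactors.erase p0).powerset : Set (Finset ℕ)) := by
    intro t _
    simp only [Finset.mem_coe, Finset.mem_powerset]
    exact Finset.filter_subset _ _
  have hinj : Set.InjOn π T := by
    intro t1 ht1 t2 ht2 heq
    have hpat : ∀ p : ℕ, p.Prime → p ∣ c → ((pl p t1 ↔ pl p0 t1) ↔ (pl p t2 ↔ pl p0 t2)) := by
      intro p hp hpc
      by_cases h : p = p0
      · subst h; simp
      have hm : p ∈ c.primeFactors.erase p0 := by
        rw [Finset.mem_erase, Nat.mem_primeFactors]; exact ⟨h, hp, hpc, by omega⟩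
      have : p ∈ π t1 ↔ p ∈ π t2 := by rw [heq]
      simp only [π, Finset.mem_filter, hm, true_and] at this
      tauto
    have q3 := ht1.2.trans ht2.2.symm
    simp only [Prod.mk.injEq] at q3
    have hfin : ∃ s : ℤ, (s = 1 ∨ s = -1) ∧ ∀ p : ℕ, p.Prime → p ∣ c → 
      (p:ℤ) ∣ (a:ℤ) ^ (t1.1/2) * (b:ℤ) ^ (t2.2.1/2) - s * ((a:ℤ) ^ (t2.1/2) * (b:ℤ) ^ (t1.2.1/2)) := by
      have hk : ∀ p : ℕ, p.Prime → p ∣ c → ¬ (p:ℤ) ∣ (a:ℤ) ^ (t0.1/2) * (b:ℤ) ^ (t0.2.1/2) := by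
        intro p hp hpc h; exact hpb p hp hpc _ (st_cancel hp (hpa p hp hpc _) h)
      by_cases hh : (pl p0 t1 ↔ pl p0 t2)
      · refine ⟨1, Or.inl rfl, ?_⟩
        intro p hp hpc
        have h3 : pl p t1 ↔ pl p t2 := st_prop1 (hpat p hp hpc) hh
        apply st_cancel hp (hk p hp hpc)
        by_cases h4 : pl p t1
        · have h5 := h3.1 h4
          rw [show (1:ℤ) = 1 * 1 by norm_num]
          exact st_comb (s1 := 1) (s2 := 1) (by norm_num) (by rw [one_mul]; exact h4) (by rw [one_mul]; exact h5)
        · have h5 := hmin p hp hpc t1 ht1 h4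
          have h6 := hmin p hp hpc t2 ht2 (fun h => h4 (h3.2 h))
          rw [show (1:ℤ) = (-1) * (-1) by norm_num]
          exact st_comb (s1 := -1) (s2 := -1) (by norm_num) (by rw [neg_one_mul, sub_neg_eq_add]; exact h5) 
            (by rw [neg_one_mul, sub_neg_eq_add]; exact h6)
      · refine ⟨-1, Or.inr rfl, ?_⟩
        intro p hp hpc
        have h3 : ¬ (pl p t1 ↔ pl p t2) := st_prop2 (hpat p hp hpc) hh
        apply st_cancel hp (hk p hp hpc)
        by_cases h4 : pl p t1
        · have h6 := hmin p hp hpc t2 ht2 (fun h => h3 (iff_of_true h4 h))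
          rw [show (-1:ℤ) = 1 * (-1) by norm_num]
          exact st_comb (s1 := 1) (s2 := -1) (by norm_num) (by rw [one_mul]; exact h4) 
            (by rw [neg_one_mul, sub_neg_eq_add]; exact h6)
        · have h5 := hmin p hp hpc t1 ht1 h4
          have h6 : pl p t2 := by
            by_contra h; exact h3 (iff_of_false h4 h)
          rw [show (-1:ℤ) = (-1) * 1 by norm_num]
          exact st_comb (s1 := -1) (s2 := 1) (by norm_num) (by rw [neg_one_mul, sub_neg_eq_add]; exact h5) 
            (by rw [one_mul]; exact h6)
    obtain ⟨s, hs, hcomp⟩ := hfin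
    rcases st_pair ha hb hc hodd hab ht1.1 ht2.1 q3.1 q3.2 s hs hcomp with h | h
    · exact h
    · exact absurd ⟨h.1, h.2.1⟩ hne
  have := Set.ncard_le_ncard_of_injOn π hmap hinj (Finset.finite_toSet _)
  rw [Set.ncard_coe_finset, Finset.card_powerset, Finset.card_erase_of_mem hp0m] at this
  exact this

lemma st_swap (a b c : ℕ) : (stS a b c).ncard = (stS b a c).ncard := by
  apply Set.ncard_congr (fun t _ => (t.2.1, t.1, t.2.2))
  · rintro t ⟨h1, h2, h3, h4⟩
    exact ⟨h2, h1, h3, by rw [add_comm]; exact h4⟩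
  · rintro ⟨x, y, z⟩ ⟨x', y', z'⟩ _ _ h
    simp only [Prod.mk.injEq] at h ⊢; tauto
  · rintro ⟨x, y, z⟩ ⟨h1, h2, h3, h4⟩
    exact ⟨(y, x, z), ⟨h2, h1, h3, by rw [add_comm]; exact h4⟩, rfl⟩

lemma st_exc_bound : (stS 3 10 13).ncard ≤ 2 := by
  have h0 : (1, 1, 1) ∈ stS 3 10 13 := by simp [stS]
  have key : ∀ t1 ∈ stS 3 10 13, ∀ t2 ∈ stS 3 10 13, t1 = t2 ∨ 
      ((t1.2.2 = 1 ∧ t2.2.2 = 3) ∨ (t1.2.2 = 3 ∧ t2.2.2 = 1)) := by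
    intro t1 ht1 t2 ht2
    have p1 := st_exc ht1.2.1 ht1.2.2.1 ht1.2.2.2
    have p2 := st_exc ht2.2.1 ht2.2.2.1 ht2.2.2.2
    have q1 := st_sol_dvd ht1 (dvd_refl 13)
    have q2 := st_sol_dvd ht2 (dvd_refl 13)
    rw [p1.1, p1.2] at q1
    rw [p2.1, p2.2] at q2
    have q := st_sign (by norm_num) (by norm_num) q1 q2
    have h13 : ∀ p : ℕ, p.Prime → p ∣ 13 → p = 13 := fun p hp h => 
      (Nat.prime_dvd_prime_iff_eq hp (by norm_num)).1 h
    have : ∃ s : ℤ, (s = 1 ∨ s = -1) ∧ ∀ p : ℕ, p.Prime → p ∣ 13 → 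
      (p:ℤ) ∣ ((3:ℕ):ℤ) ^ (t1.1/2) * ((10:ℕ):ℤ) ^ (t2.2.1/2) - s * (((3:ℕ):ℤ) ^ (t2.1/2) * ((10:ℕ):ℤ) ^ (t1.2.1/2)) := by
      rcases q with q | q
      · refine ⟨1, Or.inl rfl, fun p hp h => ?_⟩
        rw [h13 p hp h, one_mul]; exact q
      · refine ⟨-1, Or.inr rfl, fun p hp h => ?_⟩
        rw [h13 p hp h, neg_one_mul, sub_neg_eq_add]; exact q
    obtain ⟨s, hs, hcomp⟩ := this
    have := st_pair (by norm_num) (by norm_num) (by norm_num) (by decide) (by decide) ht1 ht2 (by omega) (by omega) s hs hcomp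
    exact this.imp id (fun h => h.2.2)
  have hmap : ∀ t ∈ stS 3 10 13, t.2.2 ∈ (({1, 3} : Finset ℕ) : Set ℕ) := by
    intro t ht
    rcases key _ h0 t ht with h | h
    · rw [← h]; simp
    · simp only [Finset.mem_coe, Finset.mem_insert, Finset.mem_singleton]; omega
  have := Set.ncard_le_ncard_of_injOn (fun t : ℕ × ℕ × ℕ => t.2.2) hmap (by
    intro t1 h1 t2 h2 h
    simp only at h
    rcases key _ h1 _ h2 with h' | h'
    · exact h'
    · omega) (Finset.finite_toSet _)
  rw [Set.ncard_coe_finset] at this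
  simpa using this

lemma st_coprime_bound {a b c : ℕ} (ha : 1 < a) (hb : 1 < b) (hc : 1 < c) (hodd : Odd c)
    (hab : Nat.Coprime a b) : (stS a b c).ncard ≤ 2 * 2 ^ (c.primeFactors.card - 1) := by
  by_cases hne : (((a = 3 ∧ b = 10) ∨ (a = 10 ∧ b = 3)) ∧ c = 13)
  · have h2 : (stS a b c).ncard ≤ 2 := by
      obtain ⟨⟨rfl, rfl⟩ | ⟨rfl, rfl⟩, rfl⟩ := hne
      · exact st_exc_bound
      · rw [st_swap]; exact st_exc_bound
    have : 1 ≤ 2 ^ (c.primeFactors.card - 1) := Nat.one_le_two_pow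
    omega
  · obtain ⟨P, Q, H⟩ := st_classes hc hodd hab
    have h1 := st_class_bound ha hb hc hodd hab hne P
    have h2 := st_class_bound ha hb hc hodd hab hne Q
    have : stS a b c = {t | t ∈ stS a b c ∧ (t.1 % 2, t.2.1 % 2) = P} ∪ {t | t ∈ stS a b c ∧ (t.1 % 2, t.2.1 % 2) = Q} := by
      ext t
      constructor
      · intro ht; rcases H t ht with h | h
        · exact Or.inl ⟨ht, h⟩
        · exact Or.inr ⟨ht, h⟩
      · rintro (h | h) <;> exact h.1
    rw [this]
    refine (Set.ncard_union_le _ _).trans ?_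
    omega


lemma st_S {K L : ℤ} {r : ℕ} (hco : IsCoprime K L) (hr : r.Prime) (hro : Odd r)
    (h : ∀ l : ℕ, l.Prime → (l:ℤ) ∣ ∑ i ∈ Finset.range r, K ^ i * L ^ (r - 1 - i) → (l:ℤ) ∣ K - L) :
    (∑ i ∈ Finset.range r, K ^ i * L ^ (r - 1 - i)).natAbs ≤ r := by
  set S := ∑ i ∈ Finset.range r, K ^ i * L ^ (r - 1 - i) with hS
  have hprime : ∀ l : ℕ, l.Prime → (l:ℤ) ∣ S → l = r := by
    intro l hl hd
    have h1 := h l hl hd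
    have h2 := (dvd_geom_sum₂_iff_of_dvd_sub h1 (n := r)).1 hd
    have hl' := Nat.prime_iff_prime_int.1 hl
    rcases hl'.dvd_or_dvd h2 with h3 | h3
    · exact (Nat.prime_dvd_prime_iff_eq hl hr).1 (by exact_mod_cast h3)
    · have h4 := hl'.dvd_of_dvd_pow h3
      have h5 : (l:ℤ) ∣ K := by have := dvd_add h1 h4; simpa using this
      exact (st_coprime_prime hco hl h5 h4).elim
  by_cases hone : S.natAbs = 1
  · rw [hone]; exact hr.one_lt.le
  obtain ⟨q, hq, hqd⟩ := Nat.exists_prime_and_dvd hone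
  have hrd : (r:ℤ) ∣ K - L := by
    have hq2 : (q:ℤ) ∣ S := Int.natCast_dvd.2 hqd
    have := h q hq hq2
    rwa [hprime q hq hq2] at this
  have hL : ¬ (r:ℤ) ∣ L := by
    intro hL
    have h5 : (r:ℤ) ∣ K := by have := dvd_add hrd hL; simpa using this
    exact st_coprime_prime hco hr h5 hL
  have hr2 : ¬ (r:ℤ) ^ 2 ∣ S := by
    intro h2
    obtain ⟨m, hm⟩ := hrd
    have h3 := odd_sq_dvd_geom_sum₂_sub (a := L) m hro
    rw [show L + (r:ℤ) * m = K by linarith] at h3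
    have h4 := dvd_sub h2 h3
    rw [← hS, sub_sub_cancel, sq] at h4
    have h5 : (r:ℤ) ∣ L ^ (r-1) := (mul_dvd_mul_iff_left (by exact_mod_cast hr.ne_zero)).1 h4
    exact hL ((Nat.prime_iff_prime_int.1 hr).dvd_of_dvd_pow h5)
  have hS0 : S.natAbs ≠ 0 := by
    intro h0
    apply hr2
    rw [Int.natAbs_eq_zero.1 h0]; exact dvd_zero _
  have hpow := Nat.eq_prime_pow_of_unique_prime_dvd hS0 (p := r)
    (fun {d} hd hdd => hprime d hd (Int.natCast_dvd.2 hdd))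
  generalize S.natAbs.primeFactorsList.length = n at hpow
  have hn : n < 2 := by
    by_contra hn
    apply hr2
    have : r ^ 2 ∣ S.natAbs := by rw [hpow]; exact pow_dvd_pow _ (by omega)
    exact_mod_cast Int.natCast_dvd.2 this
  rw [hpow]
  calc r ^ n ≤ r ^ 1 := Nat.pow_le_pow_right hr.pos (by omega)
    _ = r := pow_one r

lemma st_S_minus {K L : ℤ} {r : ℕ} (hL : 1 ≤ L) (hLK : L < K) (hco : IsCoprime K L) (hr : r.Prime) (hro : Odd r)
    (h : ∀ l : ℕ, l.Prime → (l:ℤ) ∣ K ^ r - L ^ r → (l:ℤ) ∣ K - L) : False := by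
  have h1 := st_S hco hr hro (by
    intro l hl hd
    apply h l hl
    rw [← geom_sum₂_mul]; exact hd.mul_right _)
  have h2 : (r:ℤ) < ∑ i ∈ Finset.range r, K ^ i * L ^ (r - 1 - i) := by
    have : (r:ℤ) = ∑ i ∈ Finset.range r, 1 := by simp
    rw [this]
    apply Finset.sum_lt_sum
    · intro i _
      have a1 : 1 ≤ K ^ i := one_le_pow₀ (by omega)
      have a2 : 1 ≤ L ^ (r - 1 - i) := one_le_pow₀ (by omega)
      nlinarith
    · refine ⟨r - 1, Finset.mem_range.2 (by have := hr.pos; omega), ?_⟩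
      rw [Nat.sub_self, pow_zero, mul_one]
      exact one_lt_pow₀ (by omega) (by have := hr.two_le; omega)
  omega

lemma st_S_plus_aux {K L : ℤ} {r : ℕ} (hL : 1 ≤ L) (hLK : L < K) (hr3 : 3 ≤ r)
    (hle : K ^ r + L ^ r ≤ r * (K + L)) : K = 2 ∧ L = 1 := by
  have h1 : K ^ (r - 1) < 2 * r := by
    have e : K ^ r = K ^ (r - 1) * K := by rw [← pow_succ]; congr 1; omega
    have : 0 < L ^ r := by positivity
    have h3 : K ^ (r - 1) * K < (2 * r) * K := by rw [← e]; nlinarith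
    exact lt_of_mul_lt_mul_right h3 (by omega)
  have hb : ∀ n : ℕ, 2 * (n + 5) ≤ 2 ^ (n + 4) := by
    intro n; induction n with
    | zero => norm_num
    | succ k ih => rw [show k + 1 + 4 = (k + 4) + 1 by ring, pow_succ]; omega
  have hr4 : r < 5 := by
    by_contra hh
    have := hb (r - 5)
    rw [show r - 5 + 5 = r by omega, show r - 5 + 4 = r - 1 by omega] at this
    have h4 : (2:ℤ) ^ (r - 1) ≤ K ^ (r - 1) := pow_le_pow_left₀ (by norm_num) (by omega) _
    have h5 : (2 * r : ℤ) ≤ 2 ^ (r - 1) := by exact_mod_cast this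
    omega
  have hK : K < 3 := by
    by_contra hh
    have h4 : (3:ℤ) ^ (r - 1) ≤ K ^ (r - 1) := pow_le_pow_left₀ (by norm_num) (by omega) _
    interval_cases r <;> norm_num at h4 h1 <;> omega
  omega

lemma st_S_plus {K L : ℤ} {r : ℕ} (hL : 1 ≤ L) (hK : 1 ≤ K) (hne : K ≠ L) (hco : IsCoprime K L) (hr : r.Prime) (hro : Odd r)
    (h : ∀ l : ℕ, l.Prime → (l:ℤ) ∣ K ^ r + L ^ r → (l:ℤ) ∣ K + L) : (K = 2 ∧ L = 1) ∨ (K = 1 ∧ L = 2) := by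
  have hg := geom_sum₂_mul K (-L) r
  rw [hro.neg_pow, sub_neg_eq_add, sub_neg_eq_add] at hg
  have h1 := st_S (L := -L) hco.neg_right hr hro (by
    intro l hl hd
    rw [sub_neg_eq_add]
    apply h l hl
    rw [← hg]; exact hd.mul_right _)
  have hle : K ^ r + L ^ r ≤ r * (K + L) := by
    rw [← hg]
    apply mul_le_mul_of_nonneg_right _ (by omega)
    omega
  have hr3 : 3 ≤ r := by
    have := hr.two_le
    rcases hro with ⟨m, hm⟩; omega
  rcases lt_or_gt_of_ne hne with hlt | hlt
  · right
    have := st_S_plus_aux hK hlt hr3 (by linarith)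
    exact ⟨this.2, this.1⟩
  · left; exact st_S_plus_aux hL hlt hr3 hle

lemma st_ineq1 {k l : ℤ} (hl : 1 ≤ l) (hlk : l < k) {s1 s2 : ℕ} (h1 : 0 < s1) (h2 : s1 < s2) :
    (k ^ s1 - l ^ s1) ^ s2 < (k ^ s2 - l ^ s2) ^ s1 := by
  have hpos : 0 < k ^ s1 - l ^ s1 := sub_pos.2 (pow_lt_pow_left₀ hlk (by omega) (by omega))
  obtain ⟨d, rfl⟩ : ∃ d, s2 = s1 + d := ⟨s2 - s1, by omega⟩
  have hl0 : 0 < l := by omega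
  have hk0 : 0 < k := by omega
  calc (k ^ s1 - l ^ s1) ^ (s1 + d) = (k ^ s1 - l ^ s1) ^ s1 * (k ^ s1 - l ^ s1) ^ d := pow_add _ _ _
    _ < (k ^ s1 - l ^ s1) ^ s1 * (k ^ s1) ^ d := by
      apply mul_lt_mul_of_pos_left _ (by positivity)
      apply pow_lt_pow_left₀ _ hpos.le (by omega)
      have : 0 < l ^ s1 := by positivity
      omega
    _ = ((k ^ s1 - l ^ s1) * k ^ d) ^ s1 := by rw [mul_pow]; ring
    _ ≤ (k ^ (s1 + d) - l ^ (s1 + d)) ^ s1 := by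
      apply pow_le_pow_left₀ (by positivity)
      rw [pow_add, pow_add, sub_mul]
      have : l ^ s1 * l ^ d ≤ l ^ s1 * k ^ d := by
        apply mul_le_mul_of_nonneg_left _ (by positivity)
        exact pow_le_pow_left₀ (by omega) hlk.le _
      omega

lemma st_ineq2_aux {e f : ℤ} (he : 1 ≤ e) (hf : e ≤ f) {s1 s2 : ℕ} (h1 : 0 < s1) (h2 : s1 < s2) :
    (e ^ s2 + f ^ s2) ^ s1 < (e ^ s1 + f ^ s1) ^ s2 := by
  obtain ⟨d, rfl⟩ : ∃ d, s2 = s1 + d := ⟨s2 - s1, by omega⟩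
  have he0 : 0 < e := by omega
  have hf0 : 0 < f := by omega
  calc (e ^ (s1 + d) + f ^ (s1 + d)) ^ s1 ≤ ((e ^ s1 + f ^ s1) * f ^ d) ^ s1 := by
        apply pow_le_pow_left₀ (by positivity)
        rw [pow_add, pow_add, add_mul]
        have : e ^ s1 * e ^ d ≤ e ^ s1 * f ^ d := by
          apply mul_le_mul_of_nonneg_left _ (by positivity)
          exact pow_le_pow_left₀ (by omega) hf _
        omega
    _ = (e ^ s1 + f ^ s1) ^ s1 * (f ^ s1) ^ d := by rw [mul_pow]; ring
    _ < (e ^ s1 + f ^ s1) ^ s1 * (e ^ s1 + f ^ s1) ^ d := by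
      apply mul_lt_mul_of_pos_left _ (by positivity)
      apply pow_lt_pow_left₀ _ (by positivity) (by omega)
      have : 0 < e ^ s1 := by positivity
      omega
    _ = _ := (pow_add _ _ _).symm

lemma st_ineq2 {e f : ℤ} (he : 1 ≤ e) (hf : 1 ≤ f) {s1 s2 : ℕ} (h1 : 0 < s1) (h2 : s1 < s2) :
    (e ^ s2 + f ^ s2) ^ s1 < (e ^ s1 + f ^ s1) ^ s2 := by
  rcases le_total e f with h | h
  · exact st_ineq2_aux he h h1 h2
  · rw [add_comm, add_comm (e ^ s1)]; exact st_ineq2_aux hf h h1 h2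

/-- ratio argument for differences -/
lemma st_gcd_minus {k l : ℤ} (hco : IsCoprime k l) {p s1 s2 : ℕ} (hp : p.Prime) (h1 : 0 < s1)
    (d1 : (p:ℤ) ∣ k ^ s1 - l ^ s1) (d2 : (p:ℤ) ∣ k ^ s2 - l ^ s2) :
    (p:ℤ) ∣ k ^ (Nat.gcd s1 s2) - l ^ (Nat.gcd s1 s2) := by
  have := Fact.mk hp
  have hl : ((l:ℤ) : ZMod p) ≠ 0 := by
    intro h
    rw [ZMod.intCast_zmod_eq_zero_iff_dvd] at h
    have h3 : (p:ℤ) ∣ k ^ s1 := by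
      have := dvd_add d1 (h.trans (dvd_pow_self l h1.ne')); simpa using this
    exact st_coprime_prime hco hp ((Nat.prime_iff_prime_int.1 hp).dvd_of_dvd_pow h3) h
  have conv : ∀ s : ℕ, (p:ℤ) ∣ k ^ s - l ^ s ↔ ((k : ZMod p) / (l : ZMod p)) ^ s = 1 := by
    intro s
    rw [← ZMod.intCast_zmod_eq_zero_iff_dvd, div_pow, div_eq_one_iff_eq (pow_ne_zero _ hl)]
    push_cast; exact sub_eq_zero
  rw [conv] at *
  rw [← orderOf_dvd_iff_pow_eq_one] at *
  exact Nat.dvd_gcd d1 d2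

/-- ratio argument for sums -/
lemma st_gcd_plus {k l : ℤ} (hco : IsCoprime k l) {p s1 s2 : ℕ} (hp : p.Prime) (hp2 : p ≠ 2) (h1 : 0 < s1)
    (d1 : (p:ℤ) ∣ k ^ s1 + l ^ s1) (d2 : (p:ℤ) ∣ k ^ s2 + l ^ s2) :
    (p:ℤ) ∣ k ^ (Nat.gcd s1 s2) + l ^ (Nat.gcd s1 s2) ∧ Odd (s2 / Nat.gcd s1 s2) := by
  have := Fact.mk hp
  have hl : ((l:ℤ) : ZMod p) ≠ 0 := by
    intro h
    rw [ZMod.intCast_zmod_eq_zero_iff_dvd] at h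
    have h3 : (p:ℤ) ∣ k ^ s1 := by
      have := dvd_sub d1 (h.trans (dvd_pow_self l h1.ne')); simpa using this
    exact st_coprime_prime hco hp ((Nat.prime_iff_prime_int.1 hp).dvd_of_dvd_pow h3) h
  have h2 : (-1 : ZMod p) ≠ 1 := by
    have : Fact (2 < p) := ⟨by have := hp.two_le; omega⟩
    exact ZMod.neg_one_ne_one
  have conv : ∀ s : ℕ, (p:ℤ) ∣ k ^ s + l ^ s ↔ ((k : ZMod p) / (l : ZMod p)) ^ s = -1 := by
    intro s
    rw [← ZMod.intCast_zmod_eq_zero_iff_dvd, div_pow, div_eq_iff (pow_ne_zero _ hl)]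
    push_cast; rw [neg_one_mul]; exact add_eq_zero_iff_eq_neg
  rw [conv] at *
  set ρ := (k : ZMod p) / (l : ZMod p)
  set g := Nat.gcd s1 s2 with hg
  have hg0 : 0 < g := Nat.gcd_pos_of_pos_left _ h1
  have hsq : (ρ ^ g) ^ 2 = 1 := by
    have e1 : ρ ^ (2 * s1) = 1 := by rw [mul_comm, pow_mul, d1]; norm_num
    have e2 : ρ ^ (2 * s2) = 1 := by rw [mul_comm, pow_mul, d2]; norm_num
    rw [← orderOf_dvd_iff_pow_eq_one] at e1 e2
    have := Nat.dvd_gcd e1 e2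
    rw [Nat.gcd_mul_left] at this
    rw [← pow_mul, mul_comm]
    exact orderOf_dvd_iff_pow_eq_one.1 this
  have hne : ρ ^ g ≠ 1 := by
    intro h
    obtain ⟨n, hn⟩ := Nat.gcd_dvd_left s1 s2
    rw [← hg] at hn
    rw [hn, pow_mul, h, one_pow] at d1
    exact h2 d1.symm
  have hm : ρ ^ g = -1 := by
    have h5 : (ρ ^ g - 1) * (ρ ^ g + 1) = 0 := by linear_combination hsq
    rcases mul_eq_zero.1 h5 with h | h
    · exact absurd (sub_eq_zero.1 h) hne
    · exact eq_neg_of_add_eq_zero_left h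
  refine ⟨hm, ?_⟩
  have e : s2 = g * (s2 / g) := (Nat.mul_div_cancel' (Nat.gcd_dvd_right s1 s2)).symm
  rw [e, pow_mul, hm] at d2
  by_contra hh
  rw [Nat.not_odd_iff_even] at hh
  rw [hh.neg_one_pow] at d2
  exact h2 d2.symm


lemma st_par4 {K L : ℤ} (h4 : (4:ℤ) ∣ K ^ 2 + L ^ 2) : Even K ∧ Even L := by
  rcases Int.even_or_odd' K with ⟨u, rfl | rfl⟩ <;> rcases Int.even_or_odd' L with ⟨v, rfl | rfl⟩
  · exact ⟨by simp, by simp⟩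
  all_goals
    ring_nf at h4
    exfalso
    omega

/-- I2 -/
lemma st_I2 {k l : ℤ} (hl : 1 ≤ l) (hlk : l < k) (hco : IsCoprime k l) {s1 s2 p : ℕ} (h1 : 0 < s1)
    (h2 : s1 < s2) (hp : p.Prime) (hp2 : p ≠ 2) (b : ℕ) (hpb : p ∣ b)
    (hb1 : ∀ q : ℕ, q.Prime → q ∣ b → (q:ℤ) ∣ k ^ s1 - l ^ s1)
    (hb2 : ∀ q : ℕ, q.Prime → ((q:ℤ) ∣ k ^ s2 - l ^ s2 ↔ q ∣ b))
    (hdiv : (k ^ s1 - l ^ s1) ^ s2 ∣ (k ^ s2 - l ^ s2) ^ s1) : False := by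
  set g := Nat.gcd s1 s2 with hg
  have hg0 : 0 < g := Nat.gcd_pos_of_pos_left _ h1
  obtain ⟨m, hm⟩ := Nat.gcd_dvd_left s1 s2
  obtain ⟨n, hn⟩ := Nat.gcd_dvd_right s1 s2
  rw [← hg] at hm hn
  set K := k ^ g with hK
  set L := l ^ g with hL
  have hL1 : 1 ≤ L := one_le_pow₀ hl
  have hLK : L < K := pow_lt_pow_left₀ hlk (by omega) (by omega)
  have hcoKL : IsCoprime K L := hco.pow
  have hgd : ∀ q : ℕ, q.Prime → q ∣ b → (q:ℤ) ∣ K - L := fun q hq hqb =>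
    st_gcd_minus hco hq h1 (hb1 q hq hqb) ((hb2 q hq).2 hqb)
  have hM2 : k ^ s2 - l ^ s2 = K ^ n - L ^ n := by rw [hn, pow_mul, pow_mul]
  have hM1 : k ^ s1 - l ^ s1 = K ^ m - L ^ m := by rw [hm, pow_mul, pow_mul]
  have hmn : m < n := by
    rw [hm, hn] at h2; exact Nat.lt_of_mul_lt_mul_left h2
  have hm0 : 0 < m := by
    rcases Nat.eq_zero_or_pos m with h | h
    · subst h; omega
    · exact h
  have hsub : ∀ r : ℕ, r ∣ n → ∀ q : ℕ, q.Prime → (q:ℤ) ∣ K ^ r - L ^ r → (q:ℤ) ∣ K - L := by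
    rintro r ⟨w, hw⟩ q hq hqd
    apply hgd q hq
    rw [← hb2 q hq, hM2, hw, pow_mul, pow_mul]
    exact hqd.trans (sub_dvd_pow_sub_pow _ _ _)
  rcases Nat.eq_two_pow_or_exists_odd_prime_and_dvd n with ⟨j, hj⟩ | ⟨r, hr, hrn, hro⟩
  swap
  · exact st_S_minus hL1 hLK hcoKL hr hro (hsub r hrn)
  have hj1 : j ≠ 0 := by rintro rfl; simp at hj; omega
  by_cases hj2 : 2 ≤ j
  · have h4 : 4 ∣ n := by rw [hj]; exact (pow_dvd_pow 2 hj2 : 2 ^ 2 ∣ 2 ^ j)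
    have h5 : ∀ q : ℕ, q.Prime → (q:ℤ) ∣ K ^ 2 + L ^ 2 → q = 2 := by
      intro q hq hqd
      have h6 := hsub 4 h4 q hq (by
        rw [show K ^ 4 - L ^ 4 = (K ^ 2 + L ^ 2) * (K ^ 2 - L ^ 2) by ring]
        exact hqd.mul_right _)
      have h7 : (q:ℤ) ∣ 2 * L ^ 2 := by
        have : 2 * L ^ 2 = (K ^ 2 + L ^ 2) - (K - L) * (K + L) := by ring
        rw [this]; exact dvd_sub hqd (h6.mul_right _)
      have hq' := Nat.prime_iff_prime_int.1 hq
      rcases hq'.dvd_or_dvd h7 with h8 | h8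
      · exact (Nat.prime_dvd_prime_iff_eq hq Nat.prime_two).1 (by exact_mod_cast h8)
      · have h9 := hq'.dvd_of_dvd_pow h8
        have h10 : (q:ℤ) ∣ K := by have := dvd_add h6 h9; simpa using this
        exact (st_coprime_prime hcoKL hq h10 h9).elim
    obtain ⟨i, hi⟩ := st_natAbs_prime_pow (by positivity) 2 h5
    have hi' : K ^ 2 + L ^ 2 = 2 ^ i := by
      have : ((K ^ 2 + L ^ 2).natAbs : ℤ) = K ^ 2 + L ^ 2 := Int.natAbs_of_nonneg (by positivity)
      rw [← this, hi]; push_cast; rfl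
    have hi2 : i < 2 := by
      by_contra hh
      have h4 : (4:ℤ) ∣ K ^ 2 + L ^ 2 := by
        rw [hi']; exact (pow_dvd_pow 2 (by omega) : (2:ℤ) ^ 2 ∣ 2 ^ i)
      have hpar := st_par4 h4
      exact st_coprime_prime hcoKL Nat.prime_two hpar.1.two_dvd hpar.2.two_dvd
    have : (2:ℤ) ^ i ≤ 2 ^ 1 := pow_le_pow_right₀ (by norm_num) (by omega)
    nlinarith
  · have hj' : j = 1 := by omega
    subst hj'
    have hn2 : n = 2 := by simpa using hj
    subst hn2
    have hm1 : m = 1 := by omega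
    subst hm1
    simp only [mul_one] at hm
    rw [hM2, hM1, hn, hm, pow_one, pow_one, show K ^ 2 - L ^ 2 = (K - L) * (K + L) by ring, mul_pow,
      mul_comm g 2, two_mul, pow_add] at hdiv
    have hpos : (K - L) ^ g ≠ 0 := pow_ne_zero _ (by omega)
    have h5 := (mul_dvd_mul_iff_left hpos).1 hdiv
    have h6 := hgd p hp hpb
    have hp' := Nat.prime_iff_prime_int.1 hp
    have h7 : (p:ℤ) ∣ K + L := hp'.dvd_of_dvd_pow ((h6.trans (dvd_pow_self _ hg0.ne')).trans h5)
    have h8 : (p:ℤ) ∣ 2 * K := by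
      have : 2 * K = (K - L) + (K + L) := by ring
      rw [this]; exact dvd_add h6 h7
    rcases hp'.dvd_or_dvd h8 with h9 | h9
    · exact hp2 ((Nat.prime_dvd_prime_iff_eq hp Nat.prime_two).1 (by exact_mod_cast h9))
    · exact st_coprime_prime hcoKL hp h9 (by have := dvd_sub h7 h9; simpa using this)

/-- 2^t+1 a power of three -/
lemma st_two_three {t j : ℕ} (h : 2 ^ t + 1 = 3 ^ j) : t = 1 ∨ t = 3 := by
  have ht : t < 4 := by
    by_contra ht
    have h16 : 2 ^ t % 16 = 0 := by
      obtain ⟨w, rfl⟩ : ∃ w, t = w + 4 := ⟨t - 4, by omega⟩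
      rw [pow_add]; omega
    have h1 : 3 ^ (j % 4) % 16 = 1 := by
      rw [← st_pow_mod (by norm_num), ← h]; omega
    have h2 : j % 4 = 0 := by
      have : j % 4 < 4 := Nat.mod_lt _ (by norm_num)
      generalize j % 4 = J at *
      interval_cases J <;> simp_all
    have h3 : 3 ^ j % 5 = 1 := by
      rw [st_pow_mod (n := 4) (by norm_num), h2]; norm_num
    have h4 : 5 ∣ 2 ^ t := by omega
    have := Nat.Prime.dvd_of_dvd_pow (by norm_num) h4
    omega
  interval_cases t
  · exfalso
    rcases Nat.eq_zero_or_pos j with rfl | hj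
    · simp at h
    · have : 3 ∣ 3 ^ j := dvd_pow_self _ hj.ne'
      omega
  · left; rfl
  · exfalso
    rcases Nat.eq_zero_or_pos j with rfl | hj
    · simp at h
    · have : 3 ∣ 3 ^ j := dvd_pow_self _ hj.ne'
      omega
  · right; rfl

lemma st_I3 {e f : ℤ} (he : 1 ≤ e) (hf : 1 ≤ f) (hco : IsCoprime e f) {t1 t2 c : ℕ} (h1 : 0 < t1)
    (h2 : t1 < t2) (hc : 1 < c) (hodd : Odd c)
    (hb1 : ∀ q : ℕ, q.Prime → q ∣ c → (q:ℤ) ∣ e ^ t1 + f ^ t1)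
    (hb2 : ∀ q : ℕ, q.Prime → ((q:ℤ) ∣ e ^ t2 + f ^ t2 ↔ q ∣ c)) :
    ((e = 2 ∧ f = 1) ∨ (e = 1 ∧ f = 2)) ∧ ∀ q : ℕ, q.Prime → q ∣ c → q = 3 := by
  have hodd' : ∀ q : ℕ, q.Prime → q ∣ c → q ≠ 2 := by
    rintro q hq hqc rfl
    exact (Nat.not_even_iff_odd.2 hodd) (even_iff_two_dvd.2 hqc)
  set g := Nat.gcd t1 t2 with hg
  have hg0 : 0 < g := Nat.gcd_pos_of_pos_left _ h1
  obtain ⟨m, hm⟩ := Nat.gcd_dvd_left t1 t2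
  obtain ⟨n, hn⟩ := Nat.gcd_dvd_right t1 t2
  rw [← hg] at hm hn
  set K := e ^ g with hK
  set L := f ^ g with hL
  have hL1 : 1 ≤ L := one_le_pow₀ hf
  have hK1 : 1 ≤ K := one_le_pow₀ he
  have hcoKL : IsCoprime K L := hco.pow
  have hgd : ∀ q : ℕ, q.Prime → q ∣ c → (q:ℤ) ∣ K + L ∧ Odd n := by
    intro q hq hqc
    have := st_gcd_plus hco hq (hodd' q hq hqc) h1 (hb1 q hq hqc) ((hb2 q hq).2 hqc)
    rw [← hg] at this
    rwa [show t2 / g = n by rw [hn]; exact Nat.mul_div_cancel_left n hg0] at this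
  have hM2 : e ^ t2 + f ^ t2 = K ^ n + L ^ n := by rw [hn, pow_mul, pow_mul]
  have hmn : m < n := by
    rw [hm, hn] at h2; exact Nat.lt_of_mul_lt_mul_left h2
  have hm0 : 0 < m := by
    rcases Nat.eq_zero_or_pos m with h | h
    · subst h; omega
    · exact h
  obtain ⟨q0, hq0, hq0c⟩ := Nat.exists_prime_and_dvd (n := c) (by omega)
  have hno := (hgd q0 hq0 hq0c).2
  have hne : K ≠ L := by
    intro h
    rw [← h, isCoprime_self, Int.isUnit_iff] at hcoKL
    have hK' : K = 1 := by omega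
    have : ((2:ℕ):ℤ) ∣ e ^ t2 + f ^ t2 := by rw [hM2, ← h, hK']; norm_num
    exact hodd' 2 Nat.prime_two ((hb2 2 Nat.prime_two).1 this) rfl
  obtain ⟨r, hr, hrn⟩ := Nat.exists_prime_and_dvd (n := n) (by omega)
  have hro : Odd r := hno.of_dvd_nat hrn
  have hKL := st_S_plus hL1 hK1 hne hcoKL hr hro (by
    intro q hq hqd
    obtain ⟨w, hw⟩ := hrn
    have hwo : Odd w := hno.of_dvd_nat ⟨r, by rw [hw]; ring⟩
    refine (hgd q hq ?_).1
    rw [← hb2 q hq, hM2, hw, pow_mul, pow_mul]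
    exact hqd.trans (Odd.add_dvd_pow_add_pow _ _ hwo))
  have hpow2 : ∀ x : ℤ, 1 ≤ x → x ^ g = 2 → g = 1 := by
    intro x hx h
    by_contra hg1
    have hx2 : 2 ≤ x := by
      by_contra hh
      have : x = 1 := by omega
      rw [this] at h; simp at h
    have : x ^ 2 ≤ x ^ g := pow_le_pow_right₀ hx (by omega)
    nlinarith
  have hg1 : g = 1 := by
    rcases hKL with h | h
    · exact hpow2 e he h.1
    · exact hpow2 f hf h.2
  have hKe : K = e := by rw [hK, hg1, pow_one]
  have hLf : L = f := by rw [hL, hg1, pow_one]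
  refine ⟨by rw [← hKe, ← hLf]; exact hKL, ?_⟩
  intro q hq hqc
  have h3 := (hgd q hq hqc).1
  have : K + L = 3 := by rcases hKL with h | h <;> omega
  rw [this] at h3
  exact (Nat.prime_dvd_prime_iff_eq hq Nat.prime_three).1 (by exact_mod_cast h3)

lemma st_le_two {α : Type*} {T : Set α} (f : α → ℕ) (hf : Set.InjOn f T)
    (h : ∀ t1 ∈ T, ∀ t2 ∈ T, ∀ t3 ∈ T, f t1 < f t2 → f t2 < f t3 → False) : T.ncard ≤ 2 := by
  by_contra hc
  push Not at hc
  have hfin : T.Finite := Set.finite_of_ncard_ne_zero (by omega)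
  obtain ⟨a, b, c, ha, hb, hc, h1, h2, h3⟩ := (Set.two_lt_ncard_iff hfin).1 hc
  have g1 : f a ≠ f b := fun h => h1 (hf ha hb h)
  have g2 : f a ≠ f c := fun h => h2 (hf ha hc h)
  have g3 : f b ≠ f c := fun h => h3 (hf hb hc h)
  rcases lt_or_gt_of_ne g1 with k1 | k1 <;> rcases lt_or_gt_of_ne g2 with k2 | k2 <;>
    rcases lt_or_gt_of_ne g3 with k3 | k3
  · exact h a ha b hb c hc k1 k3
  · exact h a ha c hc b hb k2 k3
  · omega
  · exact h c hc a ha b hb k2 k1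
  · exact h b hb a ha c hc k1 k2
  · omega
  · exact h b hb c hc a ha k3 k2
  · exact h c hc b hb a ha k3 k1

lemma st_le_one {α : Type*} {T : Set α} (f : α → ℕ) (hf : Set.InjOn f T)
    (h : ∀ t1 ∈ T, ∀ t2 ∈ T, f t1 < f t2 → False) : T.ncard ≤ 1 := by
  by_contra hc
  push Not at hc
  have hfin : T.Finite := Set.finite_of_ncard_ne_zero (by omega)
  obtain ⟨a, b, ha, hb, h1⟩ := (Set.one_lt_ncard_iff hfin).1 hc
  have g1 : f a ≠ f b := fun h => h1 (hf ha hb h)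
  rcases lt_or_gt_of_ne g1 with k1 | k1
  · exact h a ha b hb k1
  · exact h b hb a ha k1


lemma st_param {α β : ℕ} (hα : 0 < α) (hβ : 0 < β) : ∃ α' β' : ℕ, 0 < α' ∧ 0 < β' ∧ α * β' = β * α' ∧
    ∀ x y, α * x = β * y → ∃ t, x = β' * t ∧ y = α' * t := by
  obtain ⟨d, α', β', hd, hco, rfl, rfl⟩ := Nat.exists_coprime' (m := α) (n := β) (Nat.gcd_pos_of_pos_left _ hα)
  refine ⟨α', β', Nat.pos_of_mul_pos_right hα, Nat.pos_of_mul_pos_right hβ, by ring, ?_⟩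
  intro x y h
  have h1 : α' * x = β' * y := by
    apply Nat.eq_of_mul_eq_mul_left hd
    linarith
  have h2 : β' ∣ x := hco.symm.dvd_of_dvd_mul_left ⟨y, h1⟩
  obtain ⟨t, rfl⟩ := h2
  refine ⟨t, rfl, ?_⟩
  have hβ' : 0 < β' := Nat.pos_of_mul_pos_right hβ
  apply Nat.eq_of_mul_eq_mul_left hβ'
  linarith

lemma st_I1 {b y1 y2 s1 s2 : ℕ} {D M1 M2 : ℤ} (hb : 1 < b) (hD : 0 < D)
    (e1 : (b:ℤ) ^ y1 = D ^ s1 * M1) (e2 : (b:ℤ) ^ y2 = D ^ s2 * M2) (hlt : M1 ^ s2 < M2 ^ s1) :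
    M1 ^ s2 ∣ M2 ^ s1 ∧ ∀ q : ℕ, q.Prime → q ∣ b → (q:ℤ) ∣ M2 := by
  have f1 : (b:ℤ) ^ (y1 * s2) = D ^ (s1 * s2) * M1 ^ s2 := by rw [pow_mul, e1, mul_pow, pow_mul]
  have f2 : (b:ℤ) ^ (y2 * s1) = D ^ (s1 * s2) * M2 ^ s1 := by
    rw [pow_mul, e2, mul_pow, mul_comm s1, pow_mul]
  have hDp : 0 < D ^ (s1 * s2) := by positivity
  have h3 : (b:ℤ) ^ (y1 * s2) < (b:ℤ) ^ (y2 * s1) := by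
    rw [f1, f2]; exact mul_lt_mul_of_pos_left hlt hDp
  have h4 : y1 * s2 < y2 * s1 := (pow_lt_pow_iff_right₀ (by exact_mod_cast hb)).1 h3
  obtain ⟨d, hd⟩ : ∃ d, y2 * s1 = y1 * s2 + (d + 1) := ⟨y2 * s1 - y1 * s2 - 1, by omega⟩
  have h5 : M2 ^ s1 = M1 ^ s2 * (b:ℤ) ^ (d + 1) := by
    apply mul_left_cancel₀ hDp.ne'
    rw [← f2, hd, pow_add, f1]; ring
  refine ⟨⟨_, h5⟩, ?_⟩
  intro q hq hqb
  apply (Nat.prime_iff_prime_int.1 hq).dvd_of_dvd_pow (n := s1)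
  rw [h5]
  have : (q:ℤ) ∣ b := by exact_mod_cast hqb
  exact (this.trans (dvd_pow_self _ (by omega))).mul_left _

lemma st_prime_of_dvd_pow {q b y : ℕ} {D M : ℤ} (hq : q.Prime) (e : (b:ℤ) ^ y = D * M) (h : (q:ℤ) ∣ M) : q ∣ b := by
  apply hq.dvd_of_dvd_pow (n := y)
  have : (q:ℤ) ∣ (b:ℤ) ^ y := by rw [e]; exact h.mul_left _
  exact_mod_cast this

lemma st_type3 {a b c α β : ℕ} (ha : 0 < a) (hb : 0 < b) (hc : 1 < c) (hodd : Odd c) (hα : 0 < α) (hβ : 0 < β) :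
    {t | t ∈ stS a b c ∧ α * t.1 = β * t.2.1}.ncard ≤ 2 := by
  obtain ⟨α', β', hα', hβ', -, hpar⟩ := st_param hα hβ
  obtain ⟨D, e, f, hD, hco, he, hf⟩ := Nat.exists_coprime' (m := a ^ β') (n := b ^ α') (Nat.gcd_pos_of_pos_left _ (by positivity))
  have he0 : 0 < e := Nat.pos_of_mul_pos_right (he ▸ (by positivity : 0 < a ^ β'))
  have hf0 : 0 < f := Nat.pos_of_mul_pos_right (hf ▸ (by positivity : 0 < b ^ α'))
  have hcoI : IsCoprime (e:ℤ) (f:ℤ) := Nat.isCoprime_iff_coprime.2 hco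
  have hdat : ∀ t ∈ {t | t ∈ stS a b c ∧ α * t.1 = β * t.2.1}, ∃ s : ℕ, 0 < s ∧ t.1 = β' * s ∧ 
      (c:ℤ) ^ t.2.2 = (D:ℤ) ^ s * ((e:ℤ) ^ s + (f:ℤ) ^ s) := by
    rintro ⟨x, y, z⟩ ⟨⟨h1, h2, h3, h4⟩, h5⟩
    simp only at *
    obtain ⟨s, rfl, rfl⟩ := hpar x y h5
    refine ⟨s, Nat.pos_of_mul_pos_left h1, rfl, ?_⟩
    rw [pow_mul, pow_mul, he, hf] at h4
    have : (c:ℤ) ^ z = ((e:ℤ) * D) ^ s + ((f:ℤ) * D) ^ s := by exact_mod_cast h4.symm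
    rw [this, mul_pow, mul_pow]; ring
  apply st_le_two (fun t => t.1)
  · rintro ⟨x1, y1, z1⟩ ⟨⟨h1, h2, h3, h4⟩, h5⟩ ⟨x2, y2, z2⟩ ⟨⟨g1, g2, g3, g4⟩, g5⟩ h
    simp only at *
    subst h
    have hy : y1 = y2 := Nat.eq_of_mul_eq_mul_left hβ (h5.symm.trans g5)
    subst hy
    have hz : z1 = z2 := Nat.pow_right_injective hc (h4.symm.trans g4)
    subst hz; rfl
  · intro t1 ht1 t2 ht2 t3 ht3 hl1 hl2
    obtain ⟨s1, p1, q1, e1⟩ := hdat t1 ht1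
    obtain ⟨s2, p2, q2, e2⟩ := hdat t2 ht2
    obtain ⟨s3, p3, q3, e3⟩ := hdat t3 ht3
    rw [q1, q2] at hl1
    rw [q2, q3] at hl2
    have l12 : s1 < s2 := Nat.lt_of_mul_lt_mul_left hl1
    have l23 : s2 < s3 := Nat.lt_of_mul_lt_mul_left hl2
    have he1 : (1:ℤ) ≤ e := by exact_mod_cast he0
    have hf1 : (1:ℤ) ≤ f := by exact_mod_cast hf0
    have hD' : (0:ℤ) < D := by exact_mod_cast hD
    have i1 := (st_I1 hc hD' e2 e1 (st_ineq2 he1 hf1 p1 l12)).2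
    have i2 := (st_I1 hc hD' e3 e2 (st_ineq2 he1 hf1 p2 l23)).2
    obtain ⟨hef, hq⟩ := st_I3 he1 hf1 hcoI p1 l12 hc hodd i1 
      (fun q hq => ⟨fun h => st_prime_of_dvd_pow hq e2 h, i2 q hq⟩)
    have key : ∀ s z : ℕ, (c:ℤ) ^ z = (D:ℤ) ^ s * ((e:ℤ) ^ s + (f:ℤ) ^ s) → s = 1 ∨ s = 3 := by
      intro s z es
      have h1 : (e:ℤ) ^ s + (f:ℤ) ^ s = 2 ^ s + 1 := by
        rcases hef with ⟨h, h'⟩ | ⟨h, h'⟩ <;> rw [h, h', one_pow]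
        ring
      rw [h1] at es
      obtain ⟨j, hj⟩ := st_natAbs_prime_pow (n := 2 ^ s + 1) (by positivity) 3 (fun l hl hd => 
        hq l hl (st_prime_of_dvd_pow hl es hd))
      apply st_two_three (j := j)
      rw [← hj]
      have : ((2:ℤ) ^ s + 1) = ((2 ^ s + 1 : ℕ) : ℤ) := by push_cast; rfl
      rw [this, Int.natAbs_natCast]
    have k1 := key _ _ e1
    have k2 := key _ _ e2
    have k3 := key _ _ e3
    omega

lemma st_type1_data {a b c p α β γ a0 b0 c0 : ℕ} (hp : p.Prime) (ha : a = p ^ α * a0) (hb : b = p ^ β * b0)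
    (hc : c = p ^ γ * c0) (ha0 : ¬ p ∣ a0) (hc0 : ¬ p ∣ c0) (hb0 : 0 < b)
    (hα : 0 < α) (hγ : 0 < γ) : ∃ D k l γ' n : ℕ, 0 < D ∧ 0 < l ∧ Nat.Coprime k l ∧ ¬ p ∣ k ∧ 
      k ∣ c ^ n ∧ D ∣ c ^ n ∧ 0 < γ' ∧
      ∀ t ∈ {t | t ∈ stS a b c ∧ α * t.1 = γ * t.2.2 ∧ α * t.1 < β * t.2.1}, ∃ s : ℕ, 0 < s ∧ t.1 = γ' * s ∧ l < k ∧
      (b:ℤ) ^ t.2.1 = (D:ℤ) ^ s * ((k:ℤ) ^ s - (l:ℤ) ^ s) ∧ (p:ℤ) ∣ (k:ℤ) ^ s - (l:ℤ) ^ s := by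
  obtain ⟨α', γ', hα', hγ', hm, hpar⟩ := st_param hα hγ
  have ha0' : 0 < a0 := Nat.pos_of_ne_zero (by rintro rfl; simp at ha0)
  have hc0' : 0 < c0 := Nat.pos_of_ne_zero (by rintro rfl; simp at hc0)
  have hpp := hp.pos
  obtain ⟨D0, k, l, hD, hco, hk, hl⟩ := Nat.exists_coprime' (m := c0 ^ α') (n := a0 ^ γ') (Nat.gcd_pos_of_pos_left _ (by positivity))
  have hl0 : 0 < l := Nat.pos_of_mul_pos_right (hl ▸ (by positivity : 0 < a0 ^ γ'))
  have hcE : c ^ α' = k * (p ^ (α * γ') * D0) := by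
    rw [hc, mul_pow, hk, ← pow_mul, ← hm]; ring
  have haE : a ^ γ' = l * (p ^ (α * γ') * D0) := by
    rw [ha, mul_pow, hl, ← pow_mul]; ring
  have hpk : ¬ p ∣ k := by
    intro h
    apply hc0
    apply hp.dvd_of_dvd_pow (n := α')
    rw [hk]; exact h.mul_right _
  have hpD : ¬ p ∣ D0 := by
    intro h
    apply hc0
    apply hp.dvd_of_dvd_pow (n := α')
    rw [hk]; exact h.mul_left _
  refine ⟨p ^ (α * γ') * D0, k, l, γ', α', by positivity, hl0, hco, hpk, ⟨_, hcE⟩, ⟨k, by rw [hcE]; ring⟩, hγ', ?_⟩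
  rintro ⟨x, y, z⟩ ⟨⟨h1, h2, h3, h4⟩, h5, h6⟩
  simp only at *
  obtain ⟨s, rfl, rfl⟩ := hpar x z h5
  have hs : 0 < s := Nat.pos_of_mul_pos_left h1
  rw [pow_mul, pow_mul c, hcE, haE] at h4
  set D := p ^ (α * γ') * D0 with hDdef
  have hD0 : 0 < D := by positivity
  have hlk : l < k := by
    by_contra hh
    have : (k * D) ^ s ≤ (l * D) ^ s := Nat.pow_le_pow_left (Nat.mul_le_mul_right _ (not_lt.1 hh)) _
    have : 0 < b ^ y := by positivity
    omega
  have hM : (b:ℤ) ^ y = (D:ℤ) ^ s * ((k:ℤ) ^ s - (l:ℤ) ^ s) := by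
    have : ((l:ℤ) * D) ^ s + (b:ℤ) ^ y = ((k:ℤ) * D) ^ s := by exact_mod_cast h4
    rw [mul_pow, mul_pow] at this; linear_combination this
  refine ⟨s, hs, rfl, hlk, hM, ?_⟩
  have hp' := Nat.prime_iff_prime_int.1 hp
  have hd : (p:ℤ) ^ (α * γ' * s) * p ∣ (p:ℤ) ^ (α * γ' * s) * ((D0:ℤ) ^ s * ((k:ℤ) ^ s - (l:ℤ) ^ s)) := by
    rw [← pow_succ]
    have h7 : (p:ℤ) ^ (α * γ' * s) * ((D0:ℤ) ^ s * ((k:ℤ) ^ s - (l:ℤ) ^ s)) = (b:ℤ) ^ y := by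
      rw [hM, hDdef]; push_cast; rw [mul_pow, pow_mul]; ring
    rw [h7, hb]; push_cast; rw [mul_pow, ← pow_mul]
    exact (pow_dvd_pow _ (by rw [mul_assoc]; omega)).mul_right _
  have hd2 := (mul_dvd_mul_iff_left (pow_ne_zero _ hp'.ne_zero)).1 hd
  rcases hp'.dvd_or_dvd hd2 with h | h
  · exact absurd (by exact_mod_cast hp'.dvd_of_dvd_pow h) hpD
  · exact h

lemma st_type1 {a b c p α β γ a0 b0 c0 : ℕ} (hp : p.Prime) (hp2 : p ≠ 2) (ha : a = p ^ α * a0) (hb : b = p ^ β * b0)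
    (hc : c = p ^ γ * c0) (ha0 : ¬ p ∣ a0) (hc0 : ¬ p ∣ c0) (hb1 : 1 < b) (hpb : p ∣ b)
    (hα : 0 < α) (hγ : 0 < γ) (T : Set (ℕ × ℕ × ℕ)) 
    (hT : T = {t | t ∈ stS a b c ∧ α * t.1 = γ * t.2.2 ∧ α * t.1 < β * t.2.1}) :
    (c.primeFactors.card ≤ 1 → T.ncard = 0) ∧ (c.primeFactors.card ≤ 2 → T.ncard ≤ 1) ∧ T.ncard ≤ 2 := by
  obtain ⟨D, k, l, γ', n, hD, hl, hco, hpk, hkc, hDc, hγ', hdat⟩ := st_type1_data (b0 := b0) hp ha hb hc ha0 hc0 (by omega) hα hγ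
  rw [← hT] at hdat
  have hc00 : c ≠ 0 := by
    rw [hc]
    have : c0 ≠ 0 := by rintro rfl; simp at hc0
    have := hp.pos
    positivity
  have hpc : p ∈ c.primeFactors := by
    rw [Nat.mem_primeFactors]
    exact ⟨hp, by rw [hc]; exact (dvd_pow_self p hγ.ne').mul_right _, hc00⟩
  have hl' : (1:ℤ) ≤ l := by exact_mod_cast hl
  have hD' : (0:ℤ) < D := by exact_mod_cast hD
  have hcoI : IsCoprime (k:ℤ) (l:ℤ) := Nat.isCoprime_iff_coprime.2 hco
  have hinj : Set.InjOn (fun t : ℕ × ℕ × ℕ => t.1) T := by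
    rw [hT]
    rintro ⟨x1, y1, z1⟩ ⟨⟨h1, h2, h3, h4⟩, h5, -⟩ ⟨x2, y2, z2⟩ ⟨⟨g1, g2, g3, g4⟩, g5, -⟩ h
    simp only at *
    subst h
    have hz : z1 = z2 := Nat.eq_of_mul_eq_mul_left hγ (h5.symm.trans g5)
    subst hz
    have hy : y1 = y2 := Nat.pow_right_injective hb1 (by
      show b ^ y1 = b ^ y2
      omega)
    subst hy; rfl
  -- a prime factor of `k`
  have hkq : l < k → ∃ q : ℕ, q.Prime ∧ q ∣ k ∧ q ∈ c.primeFactors ∧ q ≠ p := by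
    intro hlk
    obtain ⟨q, hq, hqk⟩ := Nat.exists_prime_and_dvd (n := k) (by omega)
    refine ⟨q, hq, hqk, ?_, ?_⟩
    · rw [Nat.mem_primeFactors]; exact ⟨hq, hq.dvd_of_dvd_pow (hqk.trans hkc), hc00⟩
    · rintro rfl; exact hpk hqk
  refine ⟨?_, ?_, ?_⟩
  · intro hcard
    have : T = ∅ := by
      rw [Set.eq_empty_iff_forall_notMem]
      intro t ht
      obtain ⟨s, _, _, hlk, _⟩ := hdat t ht
      obtain ⟨q, hq, -, hqc, hqp⟩ := hkq hlk
      have : 1 < c.primeFactors.card := Finset.one_lt_card.2 ⟨q, hqc, p, hpc, hqp⟩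
      omega
    rw [this]; simp
  · intro hcard
    apply st_le_one _ hinj
    intro t1 ht1 t2 ht2 hlt
    obtain ⟨s1, p1, q1, hlk, e1, d1⟩ := hdat t1 ht1
    obtain ⟨s2, p2, q2, -, e2, d2⟩ := hdat t2 ht2
    rw [q1, q2] at hlt
    have l12 : s1 < s2 := Nat.lt_of_mul_lt_mul_left hlt
    have hlk' : (l:ℤ) < k := by exact_mod_cast hlk
    have i1 := st_I1 hb1 hD' e1 e2 (st_ineq1 hl' hlk' p1 l12)
    by_cases hall : ∀ q : ℕ, q.Prime → q ∣ b → (q:ℤ) ∣ (k:ℤ) ^ s1 - (l:ℤ) ^ s1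
    · exact st_I2 hl' hlk' hcoI p1 l12 hp hp2 b hpb hall 
        (fun q hq => ⟨fun h => st_prime_of_dvd_pow hq e2 h, i1.2 q hq⟩) i1.1
    · push Not at hall
      obtain ⟨r, hr, hrb, hrM⟩ := hall
      have hr' := Nat.prime_iff_prime_int.1 hr
      have hrp : r ≠ p := by rintro rfl; exact hrM d1
      have hrD : r ∣ D := by
        have hpos := ht1
        rw [hT] at hpos
        have h3 : (r:ℤ) ∣ (b:ℤ) ^ t1.2.1 := by
          have : (r:ℤ) ∣ b := by exact_mod_cast hrb
          exact this.trans (dvd_pow_self _ hpos.1.2.1.ne')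
        rw [e1] at h3
        have h4 := (hr'.dvd_or_dvd h3).resolve_right hrM
        exact_mod_cast hr'.dvd_of_dvd_pow h4
      have hrc : r ∈ c.primeFactors := by
        rw [Nat.mem_primeFactors]; exact ⟨hr, hr.dvd_of_dvd_pow (hrD.trans hDc), hc00⟩
      obtain ⟨q, hq, hqk, hqc, hqp⟩ := hkq hlk
      have hqr : q ≠ r := by
        rintro rfl
        have h5 := i1.2 q hq hrb
        have hqk' : (q:ℤ) ∣ k := by exact_mod_cast hqk
        have h6 : (q:ℤ) ∣ (l:ℤ) ^ s2 := by
          have := dvd_sub (hqk'.trans (dvd_pow_self _ p2.ne')) h5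
          simpa using this
        exact st_coprime_prime hcoI hq hqk' (hr'.dvd_of_dvd_pow h6)
      have : 2 < c.primeFactors.card := Finset.two_lt_card.2 ⟨q, hqc, r, hrc, p, hpc, hqr, hqp, hrp⟩
      omega
  · apply st_le_two _ hinj
    intro t1 ht1 t2 ht2 t3 ht3 hl1 hl2
    obtain ⟨s1, p1, q1, hlk, e1, d1⟩ := hdat t1 ht1
    obtain ⟨s2, p2, q2, -, e2, d2⟩ := hdat t2 ht2
    obtain ⟨s3, p3, q3, -, e3, d3⟩ := hdat t3 ht3
    rw [q1, q2] at hl1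
    rw [q2, q3] at hl2
    have l12 : s1 < s2 := Nat.lt_of_mul_lt_mul_left hl1
    have l23 : s2 < s3 := Nat.lt_of_mul_lt_mul_left hl2
    have hlk' : (l:ℤ) < k := by exact_mod_cast hlk
    have i1 := st_I1 hb1 hD' e1 e2 (st_ineq1 hl' hlk' p1 l12)
    have i2 := st_I1 hb1 hD' e2 e3 (st_ineq1 hl' hlk' p2 l23)
    exact st_I2 hl' hlk' hcoI p2 l23 hp hp2 b hpb i1.2 
        (fun q hq => ⟨fun h => st_prime_of_dvd_pow hq e3 h, i2.2 q hq⟩) i2.1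


lemma st_val {p m n u v : ℕ} (hp : p.Prime) (hu : ¬ p ∣ u) (hv : ¬ p ∣ v) (h : p ^ m * u = p ^ n * v) : m = n := by
  have key : ∀ {m n u v : ℕ}, ¬ p ∣ u → p ^ m * u = p ^ n * v → n ≤ m := by
    intro m n u v hu h
    by_contra hh
    obtain ⟨d, rfl⟩ : ∃ d, n = m + (d + 1) := ⟨n - m - 1, by omega⟩
    rw [pow_add, mul_assoc] at h
    have h2 := Nat.eq_of_mul_eq_mul_left (pow_pos hp.pos m) h
    apply hu
    rw [h2, pow_succ]
    exact ⟨p ^ d * v, by ring⟩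
  exact le_antisymm (key hv h.symm) (key hu h)

lemma st_trich {p α β γ a0 b0 c0 x y z : ℕ} (hp : p.Prime) (ha0 : ¬ p ∣ a0) (hc0 : ¬ p ∣ c0)
    (h : (p ^ α * a0) ^ x + (p ^ β * b0) ^ y = (p ^ γ * c0) ^ z) (hlt : α * x < β * y) : α * x = γ * z := by
  obtain ⟨d, hd⟩ : ∃ d, β * y = α * x + (d + 1) := ⟨β * y - α * x - 1, by omega⟩
  rw [mul_pow, mul_pow, mul_pow, ← pow_mul, ← pow_mul, ← pow_mul, hd, pow_add, mul_assoc, ← mul_add] at h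
  refine st_val hp ?_ ?_ h
  · intro hh
    have h1 : p ∣ p ^ (d + 1) * b0 ^ y := (dvd_pow_self p (by omega)).mul_right _
    exact ha0 (hp.dvd_of_dvd_pow ((Nat.dvd_add_left h1).1 hh))
  · intro hh
    exact hc0 (hp.dvd_of_dvd_pow hh)

lemma st_noncoprime_bound {a b c : ℕ} (ha : 1 < a) (hb : 1 < b) (hc : 1 < c) (hodd : Odd c)
    (hab : ¬ Nat.Coprime a b) : (stS a b c).ncard ≤ 2 * 2 ^ (c.primeFactors.card - 1) := by
  rcases (stS a b c).eq_empty_or_nonempty with he | ⟨t0, h1, h2, h3, h4⟩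
  · rw [he]; simp
  obtain ⟨p, hp, hpa, hpb⟩ := Nat.Prime.not_coprime_iff_dvd.1 hab
  have hpc : p ∣ c := by
    apply hp.dvd_of_dvd_pow (n := t0.2.2)
    rw [← h4]
    exact dvd_add (hpa.trans (dvd_pow_self _ h1.ne')) (hpb.trans (dvd_pow_self _ h2.ne'))
  have hp2 : p ≠ 2 := by
    rintro rfl
    exact (Nat.not_even_iff_odd.2 hodd) (even_iff_two_dvd.2 hpc)
  obtain ⟨α, a0, ha0, hae⟩ := Nat.exists_eq_pow_mul_and_not_dvd (n := a) (by omega) p hp.one_lt.ne'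
  obtain ⟨β, b0, hb0, hbe⟩ := Nat.exists_eq_pow_mul_and_not_dvd (n := b) (by omega) p hp.one_lt.ne'
  obtain ⟨γ, c0, hc0, hce⟩ := Nat.exists_eq_pow_mul_and_not_dvd (n := c) (by omega) p hp.one_lt.ne'
  have hα : 0 < α := by
    rcases Nat.eq_zero_or_pos α with h | h
    · subst h; rw [pow_zero, one_mul] at hae; exact absurd (hae ▸ hpa) ha0
    · exact h
  have hβ : 0 < β := by
    rcases Nat.eq_zero_or_pos β with h | h
    · subst h; rw [pow_zero, one_mul] at hbe; exact absurd (hbe ▸ hpb) hb0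
    · exact h
  have hγ : 0 < γ := by
    rcases Nat.eq_zero_or_pos γ with h | h
    · subst h; rw [pow_zero, one_mul] at hce; exact absurd (hce ▸ hpc) hc0
    · exact h
  obtain ⟨A1, A2, A3⟩ := st_type1 hp hp2 hae hbe hce ha0 hc0 hb hpb hα hγ _ rfl
  obtain ⟨B1, B2, B3⟩ := st_type1 hp hp2 hbe hae hce hb0 hc0 ha hpa hβ hγ _ rfl
  have C := st_type3 (a := a) (b := b) (by omega) (by omega) hc hodd hα hβ
  set T1 := {t | t ∈ stS a b c ∧ α * t.1 = γ * t.2.2 ∧ α * t.1 < β * t.2.1}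
  set T2' := {t | t ∈ stS b a c ∧ β * t.1 = γ * t.2.2 ∧ β * t.1 < α * t.2.1} with hT2'
  set T3 := {t | t ∈ stS a b c ∧ α * t.1 = β * t.2.1}
  set T2 := {t | t ∈ stS a b c ∧ β * t.2.1 = γ * t.2.2 ∧ β * t.2.1 < α * t.1}
  have hT2 : T2.ncard = T2'.ncard := by
    apply Set.ncard_congr (fun t _ => (t.2.1, t.1, t.2.2))
    · rintro t ⟨⟨h1, h2, h3, h4⟩, h5⟩
      exact ⟨⟨h2, h1, h3, by rw [add_comm]; exact h4⟩, h5⟩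
    · rintro ⟨x, y, z⟩ ⟨x', y', z'⟩ _ _ h
      simp only [Prod.mk.injEq] at h ⊢; exact ⟨h.2.1, h.1, h.2.2⟩
    · rintro ⟨x, y, z⟩ ⟨⟨h1, h2, h3, h4⟩, h5⟩
      exact ⟨(y, x, z), ⟨⟨h2, h1, h3, by rw [add_comm]; exact h4⟩, h5⟩, rfl⟩
  rw [← hT2] at B1 B2 B3
  have hU : stS a b c = T1 ∪ T2 ∪ T3 := by
    ext t
    constructor
    · intro ht
      have e := ht.2.2.2
      rw [hae, hbe, hce] at e
      rcases lt_trichotomy (α * t.1) (β * t.2.1) with h | h | h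
      · exact Or.inl (Or.inl ⟨ht, st_trich hp ha0 hc0 e h, h⟩)
      · exact Or.inr ⟨ht, h⟩
      · exact Or.inl (Or.inr ⟨ht, st_trich hp hb0 hc0 (by rw [add_comm]; exact e) h, h⟩)
    · rintro ((h | h) | h) <;> exact h.1
  have hle : (stS a b c).ncard ≤ T1.ncard + T2.ncard + T3.ncard := by
    rw [hU]
    have u1 := Set.ncard_union_le (T1 ∪ T2) T3
    have u2 := Set.ncard_union_le T1 T2
    omega
  generalize c.primeFactors.card = w at *
  by_cases w1 : w ≤ 1
  · have := A1 w1
    have := B1 w1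
    have : 1 ≤ 2 ^ (w - 1) := Nat.one_le_two_pow
    omega
  by_cases w2 : w ≤ 2
  · have := A2 w2
    have := B2 w2
    have : 2 ^ 1 ≤ 2 ^ (w - 1) := Nat.pow_le_pow_right (by norm_num) (by omega)
    omega
  · have : 2 ^ 2 ≤ 2 ^ (w - 1) := Nat.pow_le_pow_right (by norm_num) (by omega)
    omega

lemma st_one_left (b c : ℕ) : (stS 1 b c).ncard = 0 := by
  rcases (stS 1 b c).eq_empty_or_nonempty with he | ⟨t0, h1, h2, h3, h4⟩
  · rw [he]; simp
  apply Set.Infinite.ncard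
  refine Set.infinite_of_injective_forall_mem (f := fun n : ℕ => (n + 1, t0.2.1, t0.2.2)) ?_ ?_
  · intro m n h
    simp only [Prod.mk.injEq] at h; omega
  · intro n
    refine ⟨by simp, h2, h3, ?_⟩
    simpa using h4

theorem stmt3 (a b c : ℕ) (ha : 0 < a) (hb : 0 < b) (hc : 1 < c) (hodd : Odd c) :
    Set.ncard {p : ℕ × ℕ × ℕ | 0 < p.1 ∧ 0 < p.2.1 ∧ 0 < p.2.2 ∧
      a ^ p.1 + b ^ p.2.1 = c ^ p.2.2} ≤ 2 * 2 ^ (c.primeFactors.card - 1) := by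
  change (stS a b c).ncard ≤ _
  by_cases ha1 : a = 1
  · subst ha1; rw [st_one_left]; exact Nat.zero_le _
  by_cases hb1 : b = 1
  · subst hb1; rw [st_swap, st_one_left]; exact Nat.zero_le _
  by_cases hab : Nat.Coprime a b
  · exact st_coprime_bound (by omega) (by omega) hc hodd hab
  · exact st_noncoprime_bound (by omega) (by omega) hc hodd hab
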